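/- Let ζ be an extremal number and suppose that w_4(ζ) = 2 + √5. Then ŵ_4(ζ) = 4 and λ̂_4(ζ) = 1/4. -/

import Mathlib

open Polynomial

/-- Height of an integer polynomial: the maximum absolute value of its coefficients. -/
noncomputable def polyH (P : Polynomial ℤ) : ℝ :=
  (((P.support.sup fun i => (P.coeff i).natAbs) : ℕ) : ℝ)

/-- Evaluation of an integer polynomial at a real number. -/
noncomputable def pev (ζ : ℝ) (P : Polynomial ℤ) : ℝ := Polynomial.aeval ζ P

/-- Set of exponents η such that for arbitrarily large X the system
    H(P) ≤ X, 0 < |P(ζ)| ≤ X^(−η) has a solution of degree at most n. -/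
def wSet (n : ℕ) (ζ : ℝ) : Set ℝ :=
  {η | ∀ X₀ : ℝ, ∃ X : ℝ, X₀ ≤ X ∧ ∃ P : Polynomial ℤ,
    P.natDegree ≤ n ∧ polyH P ≤ X ∧ 0 < |pev ζ P| ∧ |pev ζ P| ≤ X ^ (-η)}

/-- The exponent w_n(ζ). -/
noncomputable def wExp (n : ℕ) (ζ : ℝ) : ℝ := sSup (wSet n ζ)

/-- Set of exponents η such that for all sufficiently large X the system
    H(P) ≤ X, 0 < |P(ζ)| ≤ X^(−η) has a solution of degree at most n. -/
def whSet (n : ℕ) (ζ : ℝ) : Set ℝ :=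
  {η | ∃ X₀ : ℝ, ∀ X : ℝ, X₀ ≤ X → ∃ P : Polynomial ℤ,
    P.natDegree ≤ n ∧ polyH P ≤ X ∧ 0 < |pev ζ P| ∧ |pev ζ P| ≤ X ^ (-η)}

/-- The uniform exponent ŵ_n(ζ). -/
noncomputable def whExp (n : ℕ) (ζ : ℝ) : ℝ := sSup (whSet n ζ)

/-- Set of exponents η such that for arbitrarily large X the system
    |x| ≤ X, max_{1≤i≤n} |ζ^i x − y_i| ≤ X^(−η) has a nonzero integer solution. -/
def lamSet (n : ℕ) (ζ : ℝ) : Set ℝ :=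
  {η | ∀ X₀ : ℝ, ∃ X : ℝ, X₀ ≤ X ∧ ∃ x : ℤ, ∃ y : Fin n → ℤ,
    (x ≠ 0 ∨ y ≠ 0) ∧ ((|x| : ℤ) : ℝ) ≤ X ∧
    ∀ i : Fin n, |ζ ^ ((i : ℕ) + 1) * (x : ℝ) - (y i : ℝ)| ≤ X ^ (-η)}

/-- The exponent λ_n(ζ). -/
noncomputable def lamExp (n : ℕ) (ζ : ℝ) : ℝ := sSup (lamSet n ζ)

/-- Set of exponents η such that for all sufficiently large X the system
    |x| ≤ X, max_{1≤i≤n} |ζ^i x − y_i| ≤ X^(−η) has a nonzero integer solution. -/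
def lamhSet (n : ℕ) (ζ : ℝ) : Set ℝ :=
  {η | ∃ X₀ : ℝ, ∀ X : ℝ, X₀ ≤ X → ∃ x : ℤ, ∃ y : Fin n → ℤ,
    (x ≠ 0 ∨ y ≠ 0) ∧ ((|x| : ℤ) : ℝ) ≤ X ∧
    ∀ i : Fin n, |ζ ^ ((i : ℕ) + 1) * (x : ℝ) - (y i : ℝ)| ≤ X ^ (-η)}

/-- The uniform exponent λ̂_n(ζ). -/
noncomputable def lamhExp (n : ℕ) (ζ : ℝ) : ℝ := sSup (lamhSet n ζ)

/-- Set of exponents η such that for arbitrarily large X the polynomial system has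
    at least j linearly independent solutions of degree at most n. -/
def wSetJ (n j : ℕ) (ζ : ℝ) : Set ℝ :=
  {η | ∀ X₀ : ℝ, ∃ X : ℝ, X₀ ≤ X ∧ ∃ P : Fin j → Polynomial ℤ,
    LinearIndependent ℤ P ∧ ∀ i : Fin j,
      (P i).natDegree ≤ n ∧ polyH (P i) ≤ X ∧ 0 < |pev ζ (P i)| ∧ |pev ζ (P i)| ≤ X ^ (-η)}

/-- The exponent w_{n,j}(ζ). -/
noncomputable def wExpJ (n j : ℕ) (ζ : ℝ) : ℝ := sSup (wSetJ n j ζ)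

/-- Set of exponents η such that for all sufficiently large X the polynomial system has
    at least j linearly independent solutions of degree at most n. -/
def whSetJ (n j : ℕ) (ζ : ℝ) : Set ℝ :=
  {η | ∃ X₀ : ℝ, ∀ X : ℝ, X₀ ≤ X → ∃ P : Fin j → Polynomial ℤ,
    LinearIndependent ℤ P ∧ ∀ i : Fin j,
      (P i).natDegree ≤ n ∧ polyH (P i) ≤ X ∧ 0 < |pev ζ (P i)| ∧ |pev ζ (P i)| ≤ X ^ (-η)}

/-- The uniform exponent ŵ_{n,j}(ζ). -/
noncomputable def whExpJ (n j : ℕ) (ζ : ℝ) : ℝ := sSup (whSetJ n j ζ)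

/-- Set of exponents η such that for arbitrarily large X the simultaneous approximation
    system has at least j linearly independent integer vector solutions. -/
def lamSetJ (n j : ℕ) (ζ : ℝ) : Set ℝ :=
  {η | ∀ X₀ : ℝ, ∃ X : ℝ, X₀ ≤ X ∧ ∃ v : Fin j → (Fin (n + 1) → ℤ),
    LinearIndependent ℤ v ∧ ∀ i : Fin j,
      ((|v i 0| : ℤ) : ℝ) ≤ X ∧
      ∀ t : Fin n, |ζ ^ ((t : ℕ) + 1) * ((v i 0 : ℤ) : ℝ) - ((v i t.succ : ℤ) : ℝ)| ≤ X ^ (-η)}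

/-- The exponent λ_{n,j}(ζ). -/
noncomputable def lamExpJ (n j : ℕ) (ζ : ℝ) : ℝ := sSup (lamSetJ n j ζ)

/-- Set of exponents η such that for all sufficiently large X the simultaneous approximation
    system has at least j linearly independent integer vector solutions. -/
def lamhSetJ (n j : ℕ) (ζ : ℝ) : Set ℝ :=
  {η | ∃ X₀ : ℝ, ∀ X : ℝ, X₀ ≤ X → ∃ v : Fin j → (Fin (n + 1) → ℤ),
    LinearIndependent ℤ v ∧ ∀ i : Fin j,
      ((|v i 0| : ℤ) : ℝ) ≤ X ∧
      ∀ t : Fin n, |ζ ^ ((t : ℕ) + 1) * ((v i 0 : ℤ) : ℝ) - ((v i t.succ : ℤ) : ℝ)| ≤ X ^ (-η)}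

/-- The uniform exponent λ̂_{n,j}(ζ). -/
noncomputable def lamhExpJ (n j : ℕ) (ζ : ℝ) : ℝ := sSup (lamhSetJ n j ζ)

/-- An extremal number: a real transcendental number with ŵ₂(ζ) = (3+√5)/2. -/
def IsExtremal (ζ : ℝ) : Prop :=
  Transcendental ℚ ζ ∧ whExp 2 ζ = (3 + Real.sqrt 5) / 2

/-- The value at `ζ` of the polynomial with coefficient vector `p`. -/
noncomputable def linVal (ζ : ℝ) {n : ℕ} (p : Fin n → ℤ) : ℝ := ∑ i, (p i : ℝ) * ζ ^ (i : ℕ)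

/-- The polynomial with coefficient vector `p`. -/
noncomputable def vecPoly {n : ℕ} (p : Fin n → ℤ) : Polynomial ℤ := ∑ i, C (p i) * X ^ (i : ℕ)

lemma vecPoly_coeff {n : ℕ} (p : Fin n → ℤ) (k : ℕ) :
    (vecPoly p).coeff k = if h : k < n then p ⟨k, h⟩ else 0 := by
  simp only [vecPoly, finsetSum_coeff, coeff_C_mul, coeff_X_pow, mul_ite, mul_one, mul_zero]
  split_ifs with h
  · rw [Finset.sum_eq_single ⟨k, h⟩]
    · simp
    · intro b _ hb
      rw [if_neg]
      rintro rfl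
      exact hb rfl
    · simp
  · apply Finset.sum_eq_zero
    intro i _
    rw [if_neg]
    have := i.2
    omega

lemma vecPoly_natDegree_le {n : ℕ} (p : Fin (n + 1) → ℤ) : (vecPoly p).natDegree ≤ n := by
  rw [natDegree_le_iff_coeff_eq_zero]
  intro N hN
  rw [vecPoly_coeff, dif_neg (by omega)]

lemma pev_vecPoly (ζ : ℝ) {n : ℕ} (p : Fin n → ℤ) : pev ζ (vecPoly p) = linVal ζ p := by
  simp [pev, vecPoly, linVal, map_sum]

lemma polyH_le {P : Polynomial ℤ} {Y : ℝ} (hY : 0 ≤ Y) (h : ∀ k, |(P.coeff k : ℝ)| ≤ Y) :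
    polyH P ≤ Y := by
  rw [polyH, ← Nat.le_floor_iff hY]
  refine Finset.sup_le fun k _ => ?_
  rw [Nat.le_floor_iff hY, Nat.cast_natAbs]
  exact_mod_cast h k

lemma abs_coeff_le_polyH (P : Polynomial ℤ) (k : ℕ) : |(P.coeff k : ℝ)| ≤ polyH P := by
  by_cases hk : k ∈ P.support
  · have := Finset.le_sup (f := fun i => (P.coeff i).natAbs) hk
    have h2 : (((P.coeff k).natAbs : ℕ) : ℝ) ≤ polyH P := by
      rw [polyH]; exact_mod_cast this
    rwa [Nat.cast_natAbs, Int.cast_abs] at h2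
  · rw [notMem_support_iff.1 hk, polyH]
    simp

lemma polyH_vecPoly_le {n : ℕ} {p : Fin n → ℤ} {Y : ℝ} (hY : 0 ≤ Y)
    (h : ∀ i, |(p i : ℝ)| ≤ Y) : polyH (vecPoly p) ≤ Y := by
  refine polyH_le hY fun k => ?_
  rw [vecPoly_coeff]
  split_ifs
  · exact h _
  · simpa using hY

lemma pev_eq_linVal (ζ : ℝ) {n : ℕ} {P : Polynomial ℤ} (hP : P.natDegree ≤ n) :
    pev ζ P = linVal ζ (fun i : Fin (n + 1) => P.coeff i) := by
  rw [pev, aeval_eq_sum_range' (Nat.lt_succ_of_le hP), linVal, Finset.sum_range]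
  simp

lemma linVal_ne_zero {ζ : ℝ} (hζ : Transcendental ℚ ζ) {n : ℕ} {p : Fin n → ℤ} (hp : p ≠ 0) :
    linVal ζ p ≠ 0 := by
  have hζ' : Transcendental ℤ ζ := fun h => hζ ((IsFractionRing.isAlgebraic_iff ℤ ℚ ℝ).1 h)
  intro h
  apply hp
  have := transcendental_iff.1 hζ' (vecPoly p) (by rw [← pev_vecPoly, pev] at h; exact h)
  funext i
  have h2 := vecPoly_coeff p i
  rw [this] at h2
  simpa using h2.symm

lemma lt_abs_linVal_of_notMem_wSet {ζ : ℝ} (hζ : Transcendental ℚ ζ) {n k : ℕ} (hk : k ≤ n) {ω : ℝ}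
    (hω : ω ∉ wSet n ζ) : ∃ X₁ : ℝ, 1 ≤ X₁ ∧ ∀ Y, X₁ ≤ Y → ∀ p : Fin (k + 1) → ℤ, p ≠ 0 →
      (∀ i, |(p i : ℝ)| ≤ Y) → Y ^ (-ω) < |linVal ζ p| := by
  simp only [wSet, Set.mem_ofPred_eq, not_forall, not_exists, not_and] at hω
  obtain ⟨X₀, h⟩ := hω
  refine ⟨max X₀ 1, le_max_right _ _, fun Y hY p hp hpY => ?_⟩
  have hY1 : 1 ≤ Y := (le_max_right _ _).trans hY
  have := h Y ((le_max_left _ _).trans hY) (vecPoly p) ((vecPoly_natDegree_le p).trans hk)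
    (polyH_vecPoly_le (by linarith) hpY)
  rw [pev_vecPoly] at this
  exact lt_of_not_ge (this (abs_pos.2 (linVal_ne_zero hζ hp)))

lemma exists_vec_of_mem_whSet {ζ : ℝ} {n : ℕ} {η : ℝ} (h : η ∈ whSet n ζ) :
    ∃ X₀ : ℝ, ∀ Y, X₀ ≤ Y → ∃ p : Fin (n + 1) → ℤ, p ≠ 0 ∧ (∀ i, |(p i : ℝ)| ≤ Y) ∧
      |linVal ζ p| ≤ Y ^ (-η) := by
  obtain ⟨X₀, h⟩ := h
  refine ⟨X₀, fun Y hY => ?_⟩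
  obtain ⟨P, hd, hH, h0, hv⟩ := h Y hY
  rw [pev_eq_linVal ζ hd] at h0 hv
  refine ⟨_, ?_, fun i => (abs_coeff_le_polyH P i).trans hH, hv⟩
  intro h
  rw [h] at h0
  simp [linVal] at h0

lemma mem_whSet_of_exists_vec {ζ : ℝ} (hζ : Transcendental ℚ ζ) {n : ℕ} {η X₀ : ℝ}
    (h : ∀ Y, X₀ ≤ Y → ∃ p : Fin (n + 1) → ℤ, p ≠ 0 ∧ (∀ i, |(p i : ℝ)| ≤ Y) ∧
      |linVal ζ p| ≤ Y ^ (-η)) : η ∈ whSet n ζ := by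
  refine ⟨max X₀ 0, fun Y hY => ?_⟩
  obtain ⟨p, hp, hH, hv⟩ := h Y ((le_max_left _ _).trans hY)
  rw [← pev_vecPoly] at hv
  exact ⟨vecPoly p, vecPoly_natDegree_le p, polyH_vecPoly_le ((le_max_right _ _).trans hY) hH,
    by rw [pev_vecPoly]; exact abs_pos.2 (linVal_ne_zero hζ hp), hv⟩

lemma mem_whSet_of_le {ζ : ℝ} {n : ℕ} {η η' : ℝ} (h : η ∈ whSet n ζ) (hη : η' ≤ η) :
    η' ∈ whSet n ζ := by
  obtain ⟨X₀, h⟩ := h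
  refine ⟨max X₀ 1, fun Y hY => ?_⟩
  obtain ⟨P, hd, hH, h0, hv⟩ := h Y ((le_max_left _ _).trans hY)
  refine ⟨P, hd, hH, h0, hv.trans ?_⟩
  exact Real.rpow_le_rpow_of_exponent_le ((le_max_right _ _).trans hY) (by linarith)

lemma mem_whSet_of_lt_whExp {ζ : ℝ} {n : ℕ} {η : ℝ} (h0 : 0 < whExp n ζ) (h : η < whExp n ζ) :
    η ∈ whSet n ζ := by
  have hne : (whSet n ζ).Nonempty := by
    rw [Set.nonempty_iff_ne_empty]
    intro he
    rw [whExp, he, Real.sSup_empty] at h0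
    exact lt_irrefl _ h0
  obtain ⟨η', h1, h2⟩ := exists_lt_of_lt_csSup hne h
  exact mem_whSet_of_le h1 h2.le

lemma notMem_wSet_of_wExp_lt {ζ : ℝ} {n : ℕ} {ω : ℝ} (h0 : 0 < wExp n ζ) (h : wExp n ζ < ω) :
    ω ∉ wSet n ζ := by
  have hb : BddAbove (wSet n ζ) := by
    by_contra hb
    rw [wExp, Real.sSup_of_not_bddAbove hb] at h0
    exact lt_irrefl _ h0
  exact fun hm => absurd (le_csSup hb hm) (not_le.2 h)

/-- A power of `Y` with larger exponent eventually absorbs a constant. -/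
lemma exists_forall_mul_rpow_le (C : ℝ) {a b : ℝ} (hab : a < b) :
    ∃ X₀ : ℝ, 1 ≤ X₀ ∧ ∀ Y, X₀ ≤ Y → C * Y ^ a ≤ Y ^ b := by
  have h := (tendsto_rpow_atTop (sub_pos.2 hab)).eventually_ge_atTop C
  obtain ⟨X₀, hX₀⟩ := Filter.eventually_atTop.1 h
  refine ⟨max X₀ 1, le_max_right _ _, fun Y hY => ?_⟩
  have h1 : 0 < Y := by linarith [le_max_right X₀ 1]
  have h2 := hX₀ Y ((le_max_left _ _).trans hY)
  calc C * Y ^ a ≤ Y ^ (b - a) * Y ^ a := by gcongr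
    _ = Y ^ b := by rw [← Real.rpow_add h1]; congr 1; ring

lemma abs_pow_le_max_one_pow (ζ : ℝ) {i n : ℕ} (h : i ≤ n) : |ζ ^ i| ≤ max 1 |ζ| ^ n := by
  rw [abs_pow]
  exact (pow_le_pow_left₀ (abs_nonneg _) (le_max_right _ _) i).trans
    (pow_le_pow_right₀ (le_max_left _ _) h)

lemma abs_floor_le (t : ℝ) : |(⌊t⌋ : ℝ)| ≤ |t| + 1 := by
  have h1 := Int.floor_le t
  have h2 := Int.lt_floor_add_one t
  have h3 := abs_le.1 (le_refl |t|)
  rw [abs_le]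
  constructor <;> linarith [h3.1, h3.2]

lemma abs_sub_floor_le (t : ℝ) : |t - ⌊t⌋| ≤ 1 := by
  have h1 := Int.floor_le t
  have h2 := Int.lt_floor_add_one t
  rw [abs_le]
  constructor <;> linarith

attribute [local instance] Matrix.seminormedAddCommGroup in
/-- Siegel's lemma with an explicit bound for the entries of the matrix. -/
lemma siegel_of_entry_le {α β : Type*} [Fintype α] [Fintype β] (A : Matrix α β ℤ)
    (hn : Fintype.card α < Fintype.card β) (hm : 0 < Fintype.card α) {M : ℝ} (hM : 1 ≤ M)
    (hA : ∀ i j, |(A i j : ℝ)| ≤ M) :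
    ∃ t : β → ℤ, t ≠ 0 ∧ A.mulVec t = 0 ∧
      ∀ j, |(t j : ℝ)| ≤ (Fintype.card β * M) ^
        ((Fintype.card α : ℝ) / (Fintype.card β - Fintype.card α)) := by
  obtain ⟨t, h0, h1, h2⟩ := Int.Matrix.exists_ne_zero_int_vec_norm_le A hn hm
  refine ⟨t, h0, h1, fun j => ?_⟩
  have hA' : ‖A‖ ≤ M := (Matrix.norm_le_iff (by linarith)).2 fun i j => by
    rw [Int.norm_eq_abs]; exact hA i j
  have h3 := (norm_le_pi_norm t j).trans h2
  rw [Int.norm_eq_abs] at h3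
  refine h3.trans (Real.rpow_le_rpow (by positivity) ?_ ?_)
  · gcongr
    exact max_le hM hA'
  · have : (Fintype.card α : ℝ) < Fintype.card β := by exact_mod_cast hn
    exact div_nonneg (by positivity) (by linarith)

lemma dirichlet_linVal (ζ : ℝ) (n : ℕ) {η : ℝ} (hη : η < n) :
    ∃ X₀ : ℝ, ∀ Y, X₀ ≤ Y → ∃ p : Fin (n + 1) → ℤ, p ≠ 0 ∧ (∀ i, |(p i : ℝ)| ≤ Y) ∧
      |linVal ζ p| ≤ Y ^ (-η) := by
  set Z : ℝ := max 1 |ζ| ^ n with hZ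
  have hZ0 : 1 ≤ Z := one_le_pow₀ (le_max_left _ _)
  set K : ℝ := (n + 2) * (Z + 1) with hK
  have hK0 : 0 < K := by positivity
  obtain ⟨X₁, hX₁, h1⟩ := exists_forall_mul_rpow_le ((n + 2) * K) (neg_lt_neg hη)
  refine ⟨max X₁ K, fun Y hY => ?_⟩
  have hY1 : 1 ≤ Y := hX₁.trans ((le_max_left _ _).trans hY)
  have hYK : K ≤ Y := (le_max_right _ _).trans hY
  have hY0 : 0 < Y := by linarith
  set D : ℝ := Y ^ (n + 1) / K with hD
  have hD1 : 1 ≤ D := by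
    rw [hD, one_le_div hK0]
    exact hYK.trans (by simpa using pow_le_pow_right₀ hY1 (Nat.le_add_left 1 n))
  let A : Matrix Unit (Fin (n + 1) ⊕ Unit) ℤ :=
    fun _ => Sum.elim (fun i => ⌊D * ζ ^ (i : ℕ)⌋) (fun _ => -1)
  have hA : ∀ i j, |(A i j : ℝ)| ≤ D * (Z + 1) := by
    rintro _ (i | _)
    · refine (abs_floor_le _).trans ?_
      rw [abs_mul, abs_of_nonneg (by linarith : 0 ≤ D)]
      have : |ζ ^ (i : ℕ)| ≤ Z := abs_pow_le_max_one_pow ζ (Nat.lt_succ_iff.1 i.2)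
      nlinarith
    · simp only [A, Sum.elim_inr]
      norm_num
      nlinarith
  obtain ⟨t, ht0, ht1, ht2⟩ := siegel_of_entry_le A (by simp) (by simp) (by nlinarith) hA
  have hb : ((Fintype.card (Fin (n + 1) ⊕ Unit) : ℝ) * (D * (Z + 1))) ^
      ((Fintype.card Unit : ℝ) / (Fintype.card (Fin (n + 1) ⊕ Unit) - Fintype.card Unit)) = Y := by
    have : (Fintype.card (Fin (n + 1) ⊕ Unit) : ℝ) * (D * (Z + 1)) = Y ^ (n + 1) := by
      simp only [Fintype.card_sum, Fintype.card_fin, Fintype.card_unit, hD, hK]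
      push_cast
      field_simp
      ring
    rw [this, ← Real.rpow_natCast, ← Real.rpow_mul hY0.le]
    simp only [Fintype.card_sum, Fintype.card_fin, Fintype.card_unit]
    push_cast
    rw [show ((n : ℝ) + 1) * (1 / (n + 1 + 1 - 1)) = 1 by field_simp; ring, Real.rpow_one]
  rw [hb] at ht2
  have hsum : (∑ i : Fin (n + 1), (⌊D * ζ ^ (i : ℕ)⌋ : ℝ) * t (Sum.inl i)) = t (Sum.inr ()) := by
    have := congrFun ht1 ()
    simp only [Matrix.mulVec, dotProduct, A, Fintype.sum_sum_type, Sum.elim_inl, Sum.elim_inr,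
      Finset.univ_unique, Finset.sum_singleton, Pi.zero_apply] at this
    have h2 : (∑ i : Fin (n + 1), ⌊D * ζ ^ (i : ℕ)⌋ * t (Sum.inl i)) = t (Sum.inr ()) := by
      have h3 : (default : Unit) = () := rfl
      rw [h3] at this
      linarith
    exact_mod_cast h2
  refine ⟨fun i => t (Sum.inl i), ?_, fun i => ht2 _, ?_⟩
  · intro h
    apply ht0
    have h' : ∀ i, t (Sum.inl i) = 0 := fun i => congrFun h i
    funext j
    rcases j with i | u
    · exact h' i
    · simp only [h', Int.cast_zero, mul_zero, Finset.sum_const_zero] at hsum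
      exact_mod_cast hsum.symm
  · have e1 : D * linVal ζ (fun i => t (Sum.inl i)) =
        t (Sum.inr ()) + ∑ i : Fin (n + 1), (D * ζ ^ (i : ℕ) - ⌊D * ζ ^ (i : ℕ)⌋) * t (Sum.inl i) := by
      rw [← hsum, ← Finset.sum_add_distrib, linVal, Finset.mul_sum]
      refine Finset.sum_congr rfl fun i _ => ?_
      ring
    have e2 : |D * linVal ζ (fun i => t (Sum.inl i))| ≤ (n + 2) * Y := by
      rw [e1]
      refine (abs_add_le _ _).trans ?_
      have : |∑ i : Fin (n + 1), (D * ζ ^ (i : ℕ) - ⌊D * ζ ^ (i : ℕ)⌋) * t (Sum.inl i)| ≤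
          ∑ i : Fin (n + 1), Y := by
        refine (Finset.abs_sum_le_sum_abs _ _).trans (Finset.sum_le_sum fun i _ => ?_)
        rw [abs_mul]
        calc _ ≤ 1 * Y := by gcongr; exacts [abs_sub_floor_le _, ht2 _]
          _ = Y := one_mul _
      simp only [Finset.sum_const, Finset.card_univ, Fintype.card_fin, nsmul_eq_mul] at this
      push_cast at this
      linarith [ht2 (Sum.inr ())]
    rw [abs_mul, abs_of_nonneg (by linarith : 0 ≤ D)] at e2
    refine le_trans ?_ (h1 Y ((le_max_left _ _).trans hY))
    rw [Real.rpow_neg hY0.le, Real.rpow_natCast]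
    have e3 : D * ((n + 2) * K * (Y ^ n)⁻¹) = (n + 2) * Y := by
      rw [hD]
      field_simp
      ring
    rw [← e3] at e2
    exact le_of_mul_le_mul_left e2 (by linarith)

/-- The quality of an integer vector as a simultaneous approximation to the powers of `ζ`. -/
noncomputable def powErr (ζ : ℝ) {n : ℕ} (x : Fin (n + 1) → ℤ) (i : Fin (n + 1)) : ℝ :=
  ζ ^ (i : ℕ) * x 0 - x i

lemma dirichlet_powErr (ζ : ℝ) (n : ℕ) (hn : 0 < n) {η : ℝ} (hη : η < 1 / n) :
    ∃ X₀ : ℝ, ∀ Y, X₀ ≤ Y → ∃ x : Fin (n + 1) → ℤ, x ≠ 0 ∧ |(x 0 : ℝ)| ≤ Y ∧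
      ∀ i, |powErr ζ x i| ≤ Y ^ (-η) := by
  set Z : ℝ := max 1 |ζ| ^ n with hZ
  have hZ0 : 1 ≤ Z := one_le_pow₀ (le_max_left _ _)
  set K : ℝ := (2 * n + 1) * (Z + 1) with hK
  have hK0 : 0 < K := by positivity
  have hK1 : 1 ≤ K := by nlinarith [(Nat.cast_nonneg n : (0:ℝ) ≤ n)]
  have hn' : (0 : ℝ) < n := by exact_mod_cast hn
  obtain ⟨X₁, hX₁, h1⟩ := exists_forall_mul_rpow_le (4 * K) (neg_lt_neg hη)
  refine ⟨max X₁ (2 * K), fun Y hY => ?_⟩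
  have hY1 : 1 ≤ Y := hX₁.trans ((le_max_left _ _).trans hY)
  have hYK : 2 * K ≤ Y := (le_max_right _ _).trans hY
  have hY0 : 0 < Y := by linarith
  set T : ℝ := Y ^ (((n : ℝ) + 1) / n) / K with hT
  have hYT : Y ^ (((n : ℝ) + 1) / n) = K * T := by rw [hT]; field_simp
  have hT2 : 2 ≤ T := by
    rw [hT, le_div_iff₀ hK0]
    refine hYK.trans ?_
    calc Y = Y ^ (1 : ℝ) := (Real.rpow_one Y).symm
      _ ≤ _ := Real.rpow_le_rpow_of_exponent_le hY1 (by rw [le_div_iff₀ hn']; linarith)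
  set D : ℤ := ⌊T⌋ with hD
  have hDT : (D : ℝ) ≤ T := Int.floor_le T
  have hTD : T < D + 1 := Int.lt_floor_add_one T
  have hD1 : (1 : ℝ) ≤ D := by
    have : (1 : ℤ) ≤ D := Int.le_floor.2 (by push_cast; linarith)
    exact_mod_cast this
  let A : Matrix (Fin n) ((Unit ⊕ Fin n) ⊕ Fin n) ℤ :=
    fun k => Sum.elim (Sum.elim (fun _ => ⌊D * ζ ^ ((k : ℕ) + 1)⌋) (fun j => if j = k then -D else 0))
      (fun j => if j = k then -1 else 0)
  have hA : ∀ i j, |(A i j : ℝ)| ≤ T * (Z + 1) := by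
    rintro k ((_ | j) | j)
    · refine (abs_floor_le _).trans ?_
      rw [abs_mul, abs_of_nonneg (by linarith : (0 : ℝ) ≤ D)]
      have : |ζ ^ ((k : ℕ) + 1)| ≤ Z := abs_pow_le_max_one_pow ζ (by omega)
      nlinarith
    · simp only [A, Sum.elim_inl, Sum.elim_inr]
      split_ifs
      · push_cast
        rw [abs_neg, abs_of_nonneg (by linarith)]
        nlinarith
      · simp
        positivity
    · simp only [A, Sum.elim_inr]
      split_ifs
      · push_cast
        rw [abs_neg, abs_one]
        nlinarith
      · simp
        positivity
  obtain ⟨t, ht0, ht1, ht2⟩ := siegel_of_entry_le A (by simp) (by simpa using hn) (by nlinarith) hA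
  have hb : ((Fintype.card ((Unit ⊕ Fin n) ⊕ Fin n) : ℝ) * (T * (Z + 1))) ^
      ((Fintype.card (Fin n) : ℝ) / (Fintype.card ((Unit ⊕ Fin n) ⊕ Fin n) - Fintype.card (Fin n)))
      = Y := by
    have : (Fintype.card ((Unit ⊕ Fin n) ⊕ Fin n) : ℝ) * (T * (Z + 1)) =
        Y ^ (((n : ℝ) + 1) / n) := by
      simp only [Fintype.card_sum, Fintype.card_fin, Fintype.card_unit, hYT, hK]
      push_cast
      ring
    rw [this, ← Real.rpow_mul hY0.le]
    simp only [Fintype.card_sum, Fintype.card_fin, Fintype.card_unit]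
    push_cast
    rw [show (((n : ℝ) + 1) / n) * (n / (1 + n + n - n)) = 1 by
      rw [show (1 : ℝ) + n + n - n = n + 1 by ring]; field_simp, Real.rpow_one]
  rw [hb] at ht2
  have heq : ∀ k : Fin n, (⌊D * ζ ^ ((k : ℕ) + 1)⌋ : ℝ) * t (Sum.inl (Sum.inl ())) -
      D * t (Sum.inl (Sum.inr k)) = t (Sum.inr k) := by
    intro k
    have := congrFun ht1 k
    simp only [Matrix.mulVec, dotProduct, A, Fintype.sum_sum_type, Sum.elim_inl, Sum.elim_inr,
      Finset.univ_unique, Finset.sum_singleton, Pi.zero_apply, ite_mul, zero_mul,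
      Finset.sum_ite_eq', Finset.mem_univ, if_true] at this
    have h3 : (default : Unit) = () := rfl
    rw [h3] at this
    have h4 : ⌊D * ζ ^ ((k : ℕ) + 1)⌋ * t (Sum.inl (Sum.inl ())) -
      D * t (Sum.inl (Sum.inr k)) = t (Sum.inr k) := by linarith
    exact_mod_cast h4
  have herr : ∀ k : Fin n, |ζ ^ ((k : ℕ) + 1) * t (Sum.inl (Sum.inl ())) - t (Sum.inl (Sum.inr k))|
      ≤ Y ^ (-η) := by
    intro k
    have e1 : D * (ζ ^ ((k : ℕ) + 1) * t (Sum.inl (Sum.inl ())) - t (Sum.inl (Sum.inr k))) =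
        t (Sum.inr k) + (D * ζ ^ ((k : ℕ) + 1) - ⌊D * ζ ^ ((k : ℕ) + 1)⌋) *
          t (Sum.inl (Sum.inl ())) := by
      rw [← heq k]; ring
    have e2 : |D * (ζ ^ ((k : ℕ) + 1) * t (Sum.inl (Sum.inl ())) - t (Sum.inl (Sum.inr k)))| ≤
        2 * Y := by
      rw [e1]
      refine (abs_add_le _ _).trans ?_
      rw [abs_mul]
      have : |D * ζ ^ ((k : ℕ) + 1) - ⌊D * ζ ^ ((k : ℕ) + 1)⌋| * |(t (Sum.inl (Sum.inl ())) : ℝ)|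
          ≤ 1 * Y := by
        gcongr
        exacts [abs_sub_floor_le _, ht2 _]
      linarith [ht2 (Sum.inr k)]
    rw [abs_mul, abs_of_nonneg (by linarith : (0 : ℝ) ≤ D)] at e2
    refine le_trans ?_ (h1 Y ((le_max_left _ _).trans hY))
    have e3 : T * (4 * K * Y ^ (-(1 / (n : ℝ)))) = 4 * Y := by
      have : T * (4 * K * Y ^ (-(1 / (n : ℝ)))) = 4 * (K * T) * Y ^ (-(1 / (n : ℝ))) := by ring
      rw [this, ← hYT, mul_assoc, ← Real.rpow_add hY0,
        show ((n : ℝ) + 1) / n + -(1 / n) = 1 by field_simp; ring, Real.rpow_one]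
    have e4 : 0 ≤ 4 * K * Y ^ (-(1 / (n : ℝ))) := by positivity
    have e5 : (D : ℝ) * |ζ ^ ((k : ℕ) + 1) * t (Sum.inl (Sum.inl ())) - t (Sum.inl (Sum.inr k))| ≤
        D * (4 * K * Y ^ (-(1 / (n : ℝ)))) := by
      refine e2.trans ?_
      nlinarith
    exact le_of_mul_le_mul_left e5 (by linarith)
  refine ⟨Fin.cons (t (Sum.inl (Sum.inl ()))) (fun k => t (Sum.inl (Sum.inr k))), ?_, ?_, ?_⟩
  · intro h
    apply ht0
    have h0 : t (Sum.inl (Sum.inl ())) = 0 := congrFun h 0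
    have hs : ∀ k, t (Sum.inl (Sum.inr k)) = 0 := fun k => by
      simpa using congrFun h k.succ
    funext j
    rcases j with (_ | k) | k
    · exact h0
    · exact hs k
    · have := heq k
      rw [h0, hs] at this
      simp only [Int.cast_zero, mul_zero, sub_zero] at this
      exact_mod_cast this.symm
  · exact ht2 _
  · intro i
    refine Fin.cases ?_ (fun k => ?_) i
    · simp [powErr]
      positivity
    · simpa [powErr] using herr k

lemma linVal_mul_sub_sum (ζ : ℝ) {n : ℕ} (p x : Fin (n + 1) → ℤ) :
    linVal ζ p * x 0 - ((∑ i, p i * x i : ℤ) : ℝ) = ∑ i, (p i : ℝ) * powErr ζ x i := by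
  rw [linVal, Finset.sum_mul]
  push_cast
  rw [← Finset.sum_sub_distrib]
  refine Finset.sum_congr rfl fun i _ => ?_
  rw [powErr]
  ring

lemma abs_sum_mul_powErr_le (ζ : ℝ) {n : ℕ} {p x : Fin (n + 1) → ℤ} {Y E : ℝ}
    (hp : ∀ i, |(p i : ℝ)| ≤ Y) (hx : ∀ i, |powErr ζ x i| ≤ E) :
    |∑ i, (p i : ℝ) * powErr ζ x i| ≤ (n + 1) * (Y * E) := by
  have hY : 0 ≤ Y := (abs_nonneg _).trans (hp 0)
  have : |∑ i, (p i : ℝ) * powErr ζ x i| ≤ ∑ i : Fin (n + 1), Y * E := by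
    refine (Finset.abs_sum_le_sum_abs _ _).trans (Finset.sum_le_sum fun i _ => ?_)
    rw [abs_mul]
    gcongr
    exacts [hp i, hx i]
  simpa using this

/-- If `p` is small at `ζ` and `x` is close to the powers of `ζ`, then they are orthogonal. -/
lemma sum_mul_eq_zero_of_small (ζ : ℝ) {n : ℕ} {p x : Fin (n + 1) → ℤ} {Y E L Z : ℝ}
    (hp : ∀ i, |(p i : ℝ)| ≤ Y) (hL : |linVal ζ p| ≤ L) (hZ : |(x 0 : ℝ)| ≤ Z)
    (hx : ∀ i, |powErr ζ x i| ≤ E) (h : L * Z + (n + 1) * (Y * E) < 1) : ∑ i, p i * x i = 0 := by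
  have h1 := linVal_mul_sub_sum ζ p x
  have h2 := abs_sum_mul_powErr_le ζ hp hx
  have h3 : |linVal ζ p * x 0| ≤ L * Z := by
    rw [abs_mul]
    have := (abs_nonneg _).trans hL
    gcongr
  have h4 : ((∑ i, p i * x i : ℤ) : ℝ) =
    linVal ζ p * x 0 - ∑ i, (p i : ℝ) * powErr ζ x i := by rw [← h1]; ring
  have h5 : |((∑ i, p i * x i : ℤ) : ℝ)| < 1 := by
    rw [h4]
    exact (abs_sub _ _).trans_lt (by linarith)
  rw [← Int.cast_abs] at h5
  have h6 : |∑ i, p i * x i| < 1 := by exact_mod_cast h5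
  exact Int.abs_lt_one_iff.1 h6

/-- Khintchine's transference inequality in dimension four. -/
lemma khintchine_transference (ζ : ℝ) {ω X₁ : ℝ} (hX₁ : 1 ≤ X₁) (hω : 3 ≤ ω)
    (hlow : ∀ Y, X₁ ≤ Y → ∀ p : Fin (4 + 1) → ℤ, p ≠ 0 →
      (∀ i, |(p i : ℝ)| ≤ Y) → Y ^ (-ω) < |linVal ζ p|) :
    ∃ c : ℝ, 0 < c ∧ ∀ x : Fin (4 + 1) → ℤ, x ≠ 0 → ∀ Z E : ℝ, E < 1 → |(x 0 : ℝ)| ≤ Z →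
      (∀ i, |powErr ζ x i| ≤ E) → c * Z ^ ((3 - ω) / 4) ≤ E := by
  set W : ℝ := max 1 |ζ| ^ 4 with hW
  have hW1 : 1 ≤ W := one_le_pow₀ (le_max_left _ _)
  set K : ℝ := 5 * (W + 1) with hK
  have hK1 : 1 ≤ K := by linarith
  refine ⟨X₁ ^ (-1 - ω) * K ^ ((-1 - ω) / 4) / 5, by positivity, fun x hx Z E hE hZ hxE => ?_⟩
  have hx0 : x 0 ≠ 0 := by
    intro h0
    apply hx
    funext i
    have := (hxE i).trans_lt hE
    rw [powErr, h0] at this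
    simp only [Int.cast_zero, mul_zero, zero_sub, abs_neg] at this
    rw [← Int.cast_abs] at this
    exact Int.abs_lt_one_iff.1 (by exact_mod_cast this)
  set z : ℝ := |(x 0 : ℝ)| with hz
  have hz1 : 1 ≤ z := by
    rw [hz, ← Int.cast_abs]
    exact_mod_cast Int.one_le_abs hx0
  have hxi : ∀ i, |(x i : ℝ)| ≤ z * (W + 1) := by
    intro i
    have h1 : (x i : ℝ) = ζ ^ (i : ℕ) * x 0 - powErr ζ x i := by rw [powErr]; ring
    have h2 : |ζ ^ (i : ℕ) * x 0| ≤ W * z := by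
      rw [abs_mul]
      have : |ζ ^ (i : ℕ)| ≤ W := abs_pow_le_max_one_pow ζ (Nat.lt_succ_iff.1 i.2)
      gcongr
    rw [h1]
    refine (abs_sub _ _).trans ?_
    linarith [hxE i]
  obtain ⟨t, ht0, ht1, ht2⟩ := siegel_of_entry_le (fun (_ : Unit) i => x i) (by simp) (by simp)
    (M := z * (W + 1)) (by nlinarith) (fun _ i => hxi i)
  have hb : ((Fintype.card (Fin (4 + 1)) : ℝ) * (z * (W + 1))) ^
      ((Fintype.card Unit : ℝ) / (Fintype.card (Fin (4 + 1)) - Fintype.card Unit)) =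
      (K * z) ^ (1 / 4 : ℝ) := by
    simp only [Fintype.card_fin, Fintype.card_unit]
    congr 1
    · rw [hK]; push_cast; ring
    · norm_num
  rw [hb] at ht2
  have hKz : 1 ≤ K * z := by nlinarith
  set B : ℝ := (K * z) ^ (1 / 4 : ℝ) with hB
  have hB1 : 1 ≤ B := Real.one_le_rpow hKz (by norm_num)
  have hB0 : 0 < B := by linarith
  have horth : ∑ i, t i * x i = 0 := by
    have := congrFun ht1 ()
    simp only [Matrix.mulVec, dotProduct, Pi.zero_apply] at this
    rw [← this]
    exact Finset.sum_congr rfl fun i _ => mul_comm _ _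
  have h1 := linVal_mul_sub_sum ζ t x
  rw [horth, Int.cast_zero, sub_zero] at h1
  have h2 := abs_sum_mul_powErr_le ζ ht2 hxE
  rw [← h1, abs_mul] at h2
  have hBX : B ≤ X₁ * B := by nlinarith
  have h3 := hlow (X₁ * B) (by nlinarith) t ht0 (fun i => (ht2 i).trans hBX)
  have hE0 : 0 ≤ E := (abs_nonneg _).trans (hxE 0)
  have h4 : (X₁ * B) ^ (-ω) * z ≤ 5 * (X₁ * B * E) := by
    have : (X₁ * B) ^ (-ω) * z ≤ |linVal ζ t| * z := by gcongr
    have h5 : B * E ≤ X₁ * B * E := by gcongr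
    push_cast at h2
    linarith
  have hXB : 0 < X₁ * B := by positivity
  have h6 : (X₁ * B) ^ (-1 - ω) * z / 5 ≤ E := by
    rw [show -1 - ω = -ω - 1 by ring, Real.rpow_sub_one hXB.ne', div_mul_eq_mul_div, div_div,
      div_le_iff₀ (by positivity)]
    linarith
  refine le_trans ?_ h6
  have h7 : (X₁ * B) ^ (-1 - ω) * z =
      X₁ ^ (-1 - ω) * K ^ ((-1 - ω) / 4) * z ^ ((3 - ω) / 4) := by
    rw [Real.mul_rpow (by linarith) hB0.le, hB, ← Real.rpow_mul (by linarith),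
      Real.mul_rpow (by linarith) (by linarith), mul_assoc, mul_assoc, mul_assoc,
      show (3 - ω) / 4 = (1 / 4 * (-1 - ω)) + 1 by ring, Real.rpow_add_one (by linarith),
      show (1 / 4 * (-1 - ω)) = (-1 - ω) / 4 by ring]
  rw [h7]
  have h8 : Z ^ ((3 - ω) / 4) ≤ z ^ ((3 - ω) / 4) :=
    Real.rpow_le_rpow_of_nonpos (by linarith) hZ (by linarith)
  have h9 : 0 < X₁ ^ (-1 - ω) * K ^ ((-1 - ω) / 4) := by positivity
  rw [div_mul_eq_mul_div]
  gcongr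

/-- Of two parallel integer vectors, one is at least as small as the other, both in its first
coordinate and as an approximation. -/
lemma powErr_le_of_parallel (ζ : ℝ) {n : ℕ} {x y : Fin (n + 1) → ℤ} {k l : ℤ} (hk : k ≠ 0)
    (hl : l ≠ 0) (h : ∀ i, k * y i = l * x i) :
    (|(y 0 : ℝ)| ≤ |(x 0 : ℝ)| ∧ ∀ i, |powErr ζ y i| ≤ |powErr ζ x i|) ∨
      (|(x 0 : ℝ)| ≤ |(y 0 : ℝ)| ∧ ∀ i, |powErr ζ x i| ≤ |powErr ζ y i|) := by
  have key : ∀ {x y : Fin (n + 1) → ℤ} {k l : ℤ}, k ≠ 0 → |l| ≤ |k| →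
      (∀ i, k * y i = l * x i) →
      |(y 0 : ℝ)| ≤ |(x 0 : ℝ)| ∧ ∀ i, |powErr ζ y i| ≤ |powErr ζ x i| := by
    intro x y k l hk hkl h
    have hk' : 0 < |(k : ℝ)| := abs_pos.2 (by exact_mod_cast hk)
    have hkl' : |(l : ℝ)| ≤ |(k : ℝ)| := by exact_mod_cast hkl
    have h' : ∀ i, (k : ℝ) * y i = l * x i := fun i => by exact_mod_cast h i
    have gen : ∀ a b : ℝ, (k : ℝ) * b = l * a → |b| ≤ |a| := by
      intro a b hab
      have h1 : |(k : ℝ)| * |b| = |(l : ℝ)| * |a| := by rw [← abs_mul, hab, abs_mul]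
      have h2 : |(k : ℝ)| * |b| ≤ |(k : ℝ)| * |a| := by rw [h1]; gcongr
      exact le_of_mul_le_mul_left h2 hk'
    refine ⟨gen _ _ (h' 0), fun i => gen _ _ ?_⟩
    rw [powErr, powErr]
    linear_combination ζ ^ (i : ℕ) * h' 0 - h' i
  rcases le_total |l| |k| with hlk | hlk
  · exact Or.inl (key hk hlk h)
  · exact Or.inr (key hl hlk fun i => (h i).symm)

lemma abs_det_le_prod {n : ℕ} (M : Matrix (Fin n) (Fin n) ℝ) (r s : Fin n → ℝ)
    (h : ∀ i j, |M i j| ≤ r i * s j) : |M.det| ≤ n.factorial * ((∏ i, r i) * ∏ i, s i) := by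
  rw [Matrix.det_apply]
  refine (Finset.abs_sum_le_sum_abs _ _).trans ?_
  have : ∀ σ ∈ (Finset.univ : Finset (Equiv.Perm (Fin n))),
      |Equiv.Perm.sign σ • ∏ i, M (σ i) i| ≤ (∏ i, r i) * ∏ i, s i := by
    intro σ _
    have h1 : |Equiv.Perm.sign σ • ∏ i, M (σ i) i| = ∏ i, |M (σ i) i| := by
      rw [← Finset.abs_prod]
      rcases Int.units_eq_one_or (Equiv.Perm.sign σ) with hs | hs <;> rw [hs] <;> simp
    rw [h1, ← Equiv.prod_comp σ r, ← Finset.prod_mul_distrib]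
    exact Finset.prod_le_prod (fun i _ => abs_nonneg _) (fun i _ => h _ _)
  refine (Finset.sum_le_sum this).trans ?_
  simp [Fintype.card_perm]

/-- The generalized cross product of `n` vectors in dimension `n + 1`. -/
def multiCross {R : Type*} [CommRing R] {n : ℕ} (v : Fin n → Fin (n + 1) → R) (i : Fin (n + 1)) : R :=
  (-1) ^ (i : ℕ) * (Matrix.of fun m j => v m (i.succAbove j)).det

lemma sum_mul_multiCross {R : Type*} [CommRing R] {n : ℕ} (v : Fin n → Fin (n + 1) → R)
    (u : Fin (n + 1) → R) :
    ∑ i, u i * multiCross v i = (Matrix.of (Fin.cons u v : Fin (n + 1) → Fin (n + 1) → R)).det := by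
  rw [Matrix.det_succ_row_zero]
  refine Finset.sum_congr rfl fun i _ => ?_
  have : (Matrix.of (Fin.cons u v : Fin (n + 1) → Fin (n + 1) → R)).submatrix Fin.succ i.succAbove =
      Matrix.of fun m j => v m (i.succAbove j) := by
    ext m j
    simp
  rw [this, multiCross]
  simp [mul_assoc, mul_left_comm]

lemma sum_mul_multiCross_self {R : Type*} [CommRing R] {n : ℕ} (v : Fin n → Fin (n + 1) → R)
    (m : Fin n) : ∑ i, v m i * multiCross v i = 0 := by
  rw [sum_mul_multiCross]
  refine Matrix.det_zero_of_row_eq (Fin.succ_ne_zero m).symm ?_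
  ext j
  simp

lemma cast_multiCross {n : ℕ} (v : Fin n → Fin (n + 1) → ℤ) (i : Fin (n + 1)) :
    ((multiCross v i : ℤ) : ℝ) = multiCross (fun m j => (v m j : ℝ)) i := by
  rw [multiCross, multiCross]
  push_cast
  congr 1

lemma multiCross_parallel {n : ℕ} {v : Fin n → Fin (n + 1) → ℤ}
    (hv : multiCross v ≠ 0) {y : Fin (n + 1) → ℤ} (hy : ∀ m, ∑ i, v m i * y i = 0) (hy0 : y ≠ 0) :
    ∃ k l : ℤ, k ≠ 0 ∧ l ≠ 0 ∧ ∀ i, k * y i = l * multiCross v i := by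
  set c := multiCross v with hc
  have hdet : (Matrix.of (Fin.cons c v : Fin (n + 1) → Fin (n + 1) → ℤ)).det = ∑ i, c i * c i := by
    rw [hc, ← sum_mul_multiCross]
  have hpos : ∑ i, c i * c i ≠ 0 := by
    intro h
    apply hv
    rw [Finset.sum_eq_zero_iff_of_nonneg (fun i _ => mul_self_nonneg _)] at h
    funext i
    exact mul_self_eq_zero.1 (h i (Finset.mem_univ i))
  have hw : (fun j => (∑ i, c i * c i) * y j - (∑ i, c i * y i) * c j) = 0 := by
    refine Matrix.eq_zero_of_mulVec_eq_zero (M := Matrix.of (Fin.cons c v)) (by rwa [hdet]) ?_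
    funext m
    have e : ∀ u : Fin (n + 1) → ℤ, ∑ j, u j * ((∑ i, c i * c i) * y j - (∑ i, c i * y i) * c j) =
        (∑ i, c i * c i) * (∑ j, u j * y j) - (∑ i, c i * y i) * ∑ j, u j * c j := by
      intro u
      rw [Finset.mul_sum (a := ∑ i, c i * c i), Finset.mul_sum (a := ∑ i, c i * y i),
        ← Finset.sum_sub_distrib]
      exact Finset.sum_congr rfl fun j _ => by ring
    refine Fin.cases ?_ (fun m => ?_) m
    · simp only [Matrix.mulVec, dotProduct, Matrix.of_apply, Fin.cons_zero, Pi.zero_apply]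
      rw [e]
      ring
    · simp only [Matrix.mulVec, dotProduct, Matrix.of_apply, Fin.cons_succ, Pi.zero_apply]
      rw [e, hy m, hc, sum_mul_multiCross_self]
      ring
  refine ⟨_, ∑ i, c i * y i, hpos, ?_, fun j => sub_eq_zero.1 (congrFun hw j)⟩
  intro h
  apply hy0
  funext j
  have := congrFun hw j
  simp only [h, zero_mul, sub_zero, Pi.zero_apply, mul_eq_zero] at this
  exact this.resolve_left hpos

/-- A nonzero vector orthogonal to the cross product can replace one of the factors. -/
lemma exists_multiCross_update_ne_zero {n : ℕ} {v : Fin n → Fin (n + 1) → ℤ}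
    (hv : multiCross v ≠ 0) {p : Fin (n + 1) → ℤ} (hp : p ≠ 0) (hpc : ∑ i, p i * multiCross v i = 0) :
    ∃ m, multiCross (Function.update v m p) ≠ 0 := by
  by_contra! h
  set c := multiCross v with hc
  set A := Matrix.of (Fin.cons c v : Fin (n + 1) → Fin (n + 1) → ℤ) with hA
  have hdet : A.det ≠ 0 := by
    rw [hA, hc, ← sum_mul_multiCross]
    intro h
    apply hv
    rw [← hc, Finset.sum_eq_zero_iff_of_nonneg (fun i _ => mul_self_nonneg _)] at h
    funext i
    exact mul_self_eq_zero.1 (h i (Finset.mem_univ i))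
  have h0 : Matrix.cramer A.transpose p = 0 := by
    funext k
    rw [Matrix.cramer_transpose_apply]
    refine Fin.cases ?_ (fun m => ?_) k
    · have : A.updateRow 0 p = Matrix.of (Fin.cons p v) := by
        ext i j
        refine Fin.cases ?_ (fun m => ?_) i
        · simp
        · rw [Matrix.updateRow_ne (Fin.succ_ne_zero m), hA]
          simp
      rw [this, ← sum_mul_multiCross]
      exact hpc
    · have : A.updateRow m.succ p = Matrix.of (Fin.cons c (Function.update v m p)) := by
        ext i j
        refine Fin.cases ?_ (fun m' => ?_) i
        · rw [Matrix.updateRow_ne (Fin.succ_ne_zero m).symm, hA]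
          simp only [Matrix.of_apply, Fin.cons_zero]
        · by_cases hm : m' = m
          · subst hm
            simp
          · rw [Matrix.updateRow_ne (by simpa using hm), hA]
            simp [hm]
      rw [this, ← sum_mul_multiCross, h m]
      simp
  have h1 := Matrix.mulVec_cramer A.transpose p
  rw [h0, Matrix.mulVec_zero, Matrix.det_transpose] at h1
  apply hp
  funext i
  have := congrFun h1 i
  simp only [Pi.zero_apply, Pi.smul_apply, smul_eq_mul] at this
  exact (mul_eq_zero.1 this.symm).resolve_left hdet

lemma abs_multiCross_zero_le {n : ℕ} {v : Fin n → Fin (n + 1) → ℤ} {a : Fin n → ℝ}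
    (h : ∀ m i, |(v m i : ℝ)| ≤ a m) :
    |((multiCross v 0 : ℤ) : ℝ)| ≤ n.factorial * ∏ m, a m := by
  rw [cast_multiCross, multiCross]
  simp only [Fin.val_zero, pow_zero, one_mul]
  refine (abs_det_le_prod _ a (fun _ => 1) fun m j => ?_).trans (by simp)
  simpa using h m _

lemma det_updateCol_mulVec {R : Type*} [CommRing R] {n : ℕ} (M : Matrix (Fin n) (Fin n) R)
    (z : Fin n → R) (i : Fin n) : (M.updateCol i (M.mulVec z)).det = M.det * z i := by
  rw [← Matrix.cramer_apply, Matrix.cramer_eq_adjugate_mulVec, Matrix.mulVec_mulVec,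
    Matrix.adjugate_mul, Matrix.smul_mulVec, Matrix.one_mulVec]
  rfl

lemma abs_powErr_multiCross_le (ζ : ℝ) {n : ℕ} {v : Fin n → Fin (n + 1) → ℤ} {a : Fin n → ℝ} {θ : ℝ}
    (hθ : 0 ≤ θ) (h : ∀ m i, |(v m i : ℝ)| ≤ a m) (hv : ∀ m, |linVal ζ (v m)| ≤ a m * θ)
    (i : Fin (n + 1)) :
    |powErr ζ (multiCross v) i| ≤ (n + 1).factorial * ((∏ m, a m) * θ) := by
  rcases eq_or_ne i 0 with rfl | hi
  · have : 0 ≤ ∏ m, a m := Finset.prod_nonneg fun m _ => (abs_nonneg _).trans (h m 0)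
    rw [powErr]
    simp
    positivity
  set u : Fin (n + 1) → ℝ := fun j => ζ ^ (i : ℕ) * (if j = 0 then 1 else 0) - if j = i then 1 else 0
    with hu
  set M : Matrix (Fin (n + 1)) (Fin (n + 1)) ℝ :=
    Matrix.of (Fin.cons u (fun m j => (v m j : ℝ)) : Fin (n + 1) → Fin (n + 1) → ℝ) with hM
  have h1 : powErr ζ (multiCross v) i = M.det := by
    rw [hM, ← sum_mul_multiCross, powErr, cast_multiCross, cast_multiCross]
    simp [hu, sub_mul, Finset.sum_sub_distrib]
  have h2 := det_updateCol_mulVec M (fun j => ζ ^ (j : ℕ)) 0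
  simp only [Fin.val_zero, pow_zero, mul_one] at h2
  rw [h1, ← h2]
  refine (abs_det_le_prod _ (Fin.cons 1 a) (Fin.cons θ fun _ => 1) fun k j => ?_).trans ?_
  · refine Fin.cases ?_ (fun j => ?_) j
    · rw [Matrix.updateCol_self]
      refine Fin.cases ?_ (fun m => ?_) k
      · have : (M.mulVec fun j => ζ ^ (j : ℕ)) 0 = 0 := by
          simp [Matrix.mulVec, dotProduct, hM, hu, sub_mul, Finset.sum_sub_distrib]
        rw [this]
        simpa using hθ
      · have : (M.mulVec fun j => ζ ^ (j : ℕ)) m.succ = linVal ζ (v m) := by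
          simp [Matrix.mulVec, dotProduct, hM, linVal]
        rw [this]
        simpa using hv m
    · rw [Matrix.updateCol_ne (Fin.succ_ne_zero j)]
      refine Fin.cases ?_ (fun m => ?_) k
      · simp only [hM, Matrix.of_apply, Fin.cons_zero, Fin.cons_succ, hu, Fin.succ_ne_zero, if_false,
          mul_zero, zero_sub, abs_neg, mul_one]
        split_ifs <;> simp
      · simpa [hM] using h m j.succ
  · simp [Fin.prod_univ_succ]

lemma exists_forall_mul_rpow_le_one (C : ℝ) {a : ℝ} (ha : a < 0) :
    ∃ X₀ : ℝ, 1 ≤ X₀ ∧ ∀ Y, X₀ ≤ Y → C * Y ^ a ≤ 1 := by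
  obtain ⟨X₀, h1, h⟩ := exists_forall_mul_rpow_le C ha
  exact ⟨X₀, h1, fun Y hY => by simpa using h Y hY⟩

section Four

variable {ζ w : ℝ}

lemma no_short_point (hw : 4 < w)
    (hlow : ∀ ω, w < ω → ∃ X₁ : ℝ, 1 ≤ X₁ ∧ ∀ Y, X₁ ≤ Y → ∀ p : Fin (4 + 1) → ℤ, p ≠ 0 →
      (∀ i, |(p i : ℝ)| ≤ Y) → Y ^ (-ω) < |linVal ζ p|) {κ : ℝ} (hκ : 0 < κ) (hκ1 : κ ≤ 1) :
    ∃ X₀ : ℝ, 1 ≤ X₀ ∧ ∀ X, X₀ ≤ X → ∀ x : Fin (4 + 1) → ℤ, x ≠ 0 → |(x 0 : ℝ)| ≤ X ^ (4 - κ) →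
      ¬ ∀ i, |powErr ζ x i| ≤ 120 * X ^ (3 - w + κ / 10) := by
  obtain ⟨X₁, hX₁, h⟩ := hlow (w + κ / 10) (by linarith)
  obtain ⟨c, hc, hK⟩ := khintchine_transference ζ hX₁ (by linarith) h
  obtain ⟨X₂, hX₂, h2⟩ := exists_forall_mul_rpow_le_one 240 (a := 3 - w + κ / 10) (by linarith)
  obtain ⟨X₃, hX₃, h3⟩ := exists_forall_mul_rpow_le (240 / c) (a := 3 - w + κ / 10)
    (b := (4 - κ) * ((3 - (w + κ / 10)) / 4)) (by nlinarith)
  refine ⟨max X₂ X₃, hX₂.trans (le_max_left _ _), fun X hX x hx hx0 hxE => ?_⟩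
  have hX1 : 1 ≤ X := (hX₂.trans (le_max_left _ _)).trans hX
  have hpos : 0 < X ^ (3 - w + κ / 10) := by positivity
  have e2 := h2 X ((le_max_left _ _).trans hX)
  have e3 := h3 X ((le_max_right _ _).trans hX)
  have e4 := hK x hx _ _ (by linarith) hx0 hxE
  rw [← Real.rpow_mul (by linarith)] at e4
  rw [div_mul_eq_mul_div, div_le_iff₀ hc] at e3
  linarith

lemma multiCross_four_bounds {ε X : ℝ} (hX : 1 ≤ X) {v : Fin 4 → Fin (4 + 1) → ℤ}
    (hv : ∀ m i, |(v m i : ℝ)| ≤ X) (hval : ∀ m, |linVal ζ (v m)| ≤ X ^ (-w + ε)) :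
    |((multiCross v 0 : ℤ) : ℝ)| ≤ 24 * X ^ (4 : ℝ) ∧
      ∀ i, |powErr ζ (multiCross v) i| ≤ 120 * X ^ (3 - w + ε) := by
  have hX0 : 0 < X := by linarith
  constructor
  · have := abs_multiCross_zero_le hv
    simpa [Nat.factorial] using this
  · intro i
    have := abs_powErr_multiCross_le ζ (a := fun _ => X) (θ := X ^ (-w + ε - 1)) (by positivity) hv
      (fun m => by
        refine (hval m).trans (le_of_eq ?_)
        rw [Real.rpow_sub_one hX0.ne']
        field_simp) i
    refine this.trans (le_of_eq ?_)
    have e : 3 - w + ε = 4 + (-w + ε - 1) := by ring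
    rw [e, Real.rpow_add hX0]
    norm_num [Nat.factorial]

variable (hw : 4 < w)
    (hlow : ∀ ω, w < ω → ∃ X₁ : ℝ, 1 ≤ X₁ ∧ ∀ Y, X₁ ≤ Y → ∀ p : Fin (4 + 1) → ℤ, p ≠ 0 →
      (∀ i, |(p i : ℝ)| ≤ Y) → Y ^ (-ω) < |linVal ζ p|)
    (hfour : ∀ ε, 0 < ε → ∀ X₀ : ℝ, ∃ X, X₀ ≤ X ∧ ∃ v : Fin 4 → Fin (4 + 1) → ℤ,
      multiCross v ≠ 0 ∧ (∀ m i, |(v m i : ℝ)| ≤ X) ∧ ∀ m, |linVal ζ (v m)| ≤ X ^ (-w + ε))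
include hw hlow hfour

lemma not_uniform_powErr {η : ℝ} (hη : 1 / 4 < η) :
    ¬ ∃ X₀ : ℝ, ∀ Y, X₀ ≤ Y → ∃ x : Fin (4 + 1) → ℤ, x ≠ 0 ∧ |(x 0 : ℝ)| ≤ Y ∧
      ∀ i, |powErr ζ x i| ≤ Y ^ (-η) := by
  rintro ⟨Y₀, hY⟩
  set κ : ℝ := min 1 ((4 * η - 1) / (2 * η)) with hκ
  have hη0 : 0 < η := by linarith
  have hκ0 : 0 < κ := lt_min one_pos (div_pos (by linarith) (by linarith))
  have hκ1 : κ ≤ 1 := min_le_left _ _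
  have hκη : 1 < (4 - κ) * η := by
    have h1 : κ ≤ (4 * η - 1) / (2 * η) := min_le_right _ _
    rw [le_div_iff₀ (by positivity)] at h1
    linarith
  obtain ⟨X₁, hX₁, h1⟩ := no_short_point hw hlow hκ0 hκ1
  obtain ⟨X₂, hX₂, h2⟩ := exists_forall_mul_rpow_le_one 3 (a := -w + κ / 10 + (4 - κ)) (by linarith)
  obtain ⟨X₃, hX₃, h3⟩ := exists_forall_mul_rpow_le_one 15 (a := 1 + (4 - κ) * -η) (by linarith)
  obtain ⟨X, hX, v, hv0, hvX, hval⟩ := hfour (κ / 10) (by positivity)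
    (max (max X₁ X₂) (max X₃ Y₀))
  have hXX₁ := ((le_max_left _ _).trans (le_max_left _ _)).trans hX
  have hXX₂ := ((le_max_right _ _).trans (le_max_left _ _)).trans hX
  have hXX₃ := ((le_max_left _ _).trans (le_max_right _ _)).trans hX
  have hXY₀ := ((le_max_right _ _).trans (le_max_right _ _)).trans hX
  have hX1 : 1 ≤ X := hX₁.trans hXX₁
  have hX0 : 0 < X := by linarith
  have hYX : X ≤ X ^ (4 - κ) := by
    simpa using Real.rpow_le_rpow_of_exponent_le hX1 (show 1 ≤ 4 - κ by linarith)
  obtain ⟨y, hy0, hyY, hyE⟩ := hY (X ^ (4 - κ)) (hXY₀.trans hYX)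
  obtain ⟨hc1, hc2⟩ := multiCross_four_bounds hX1 hvX hval
  have horth : ∀ m, ∑ i, v m i * y i = 0 := fun m => by
    refine sum_mul_eq_zero_of_small ζ (hvX m) (hval m) hyY hyE ?_
    have e2 := h2 X hXX₂
    have e3 := h3 X hXX₃
    rw [Real.rpow_add hX0] at e2 e3
    rw [Real.rpow_mul hX0.le, Real.rpow_one] at e3
    push_cast
    linarith
  obtain ⟨k, l, hk, hl, hkl⟩ := multiCross_parallel hv0 horth hy0
  rcases powErr_le_of_parallel ζ hk hl hkl with ⟨-, h⟩ | ⟨h0, h⟩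
  · exact h1 X hXX₁ y hy0 hyY fun i => (h i).trans (hc2 i)
  · exact h1 X hXX₁ _ hv0 (h0.trans hyY) hc2

lemma not_uniform_linVal {η : ℝ} (hη : 4 < η) :
    ¬ ∃ X₀ : ℝ, ∀ Y, X₀ ≤ Y → ∃ p : Fin (4 + 1) → ℤ, p ≠ 0 ∧ (∀ i, |(p i : ℝ)| ≤ Y) ∧
      |linVal ζ p| ≤ Y ^ (-η) := by
  rintro ⟨Y₀, hY⟩
  set κ : ℝ := (η - 4) / (2 * η) with hκ
  have hη0 : 0 < η := by linarith
  have hκ0 : 0 < κ := div_pos (by linarith) (by linarith)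
  have hκη' : κ * (2 * η) = η - 4 := by rw [hκ]; field_simp
  have hκ1 : κ ≤ 1 / 2 := by rw [hκ, div_le_iff₀ (by positivity)]; linarith
  have hκη : 4 < (1 - κ) * η := by linarith
  obtain ⟨X₁, hX₁, h1⟩ := no_short_point hw hlow (half_pos hκ0) (by linarith)
  obtain ⟨X₂, hX₂, h2⟩ := exists_forall_mul_rpow_le_one 72 (a := (1 - κ) * -η + 4) (by linarith)
  obtain ⟨X₃, hX₃, h3⟩ := exists_forall_mul_rpow_le_one 1800
    (a := (1 - κ) + (3 - w + κ / 2 / 10)) (by linarith)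
  obtain ⟨X₄, hX₄, h4⟩ := exists_forall_mul_rpow_le 24 (a := 4 - κ) (b := 4 - κ / 2) (by linarith)
  obtain ⟨X₅, hX₅, h5⟩ := exists_forall_mul_rpow_le Y₀ (a := 0) (b := 1 - κ) (by linarith)
  obtain ⟨X, hX, v, hv0, hvX, hval⟩ := hfour (κ / 2 / 10) (by positivity)
    (max (max X₁ X₂) (max X₃ (max X₄ X₅)))
  simp only [max_le_iff] at hX
  obtain ⟨⟨hXX₁, hXX₂⟩, hXX₃, hXX₄, hXX₅⟩ := hX
  have hX1 : 1 ≤ X := hX₁.trans hXX₁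
  have hX0 : 0 < X := by linarith
  obtain ⟨p, hp0, hpY, hpv⟩ := hY (X ^ (1 - κ)) (by simpa using h5 X hXX₅)
  obtain ⟨hc1, hc2⟩ := multiCross_four_bounds hX1 hvX hval
  have horth : ∑ i, p i * multiCross v i = 0 := by
    refine sum_mul_eq_zero_of_small ζ hpY hpv hc1 hc2 ?_
    have e2 := h2 X hXX₂
    have e3 := h3 X hXX₃
    rw [Real.rpow_add hX0] at e2 e3
    rw [Real.rpow_mul hX0.le] at e2
    push_cast
    linarith
  obtain ⟨m, hm⟩ := exists_multiCross_update_ne_zero hv0 hp0 horth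
  have hsmall : |((multiCross (Function.update v m p) 0 : ℤ) : ℝ)| ≤ X ^ (4 - κ / 2) := by
    have := abs_multiCross_zero_le (v := Function.update v m p)
      (a := Function.update (fun _ => X) m (X ^ (1 - κ))) (fun m' i => by
        rcases eq_or_ne m' m with rfl | h
        · simpa using hpY i
        · simpa [h] using hvX m' i)
    refine this.trans ((le_of_eq ?_).trans (h4 X hXX₄))
    rw [Finset.prod_update_of_mem (Finset.mem_univ _), Finset.prod_const,
      Finset.card_sdiff_of_subset (by simp)]
    have e : 4 - κ = (1 - κ) + (3 : ℕ) := by push_cast; ring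
    rw [e, Real.rpow_add hX0, Real.rpow_natCast]
    simp [Nat.factorial]
  obtain ⟨k, l, hk, hl, hkl⟩ := multiCross_parallel hm (y := multiCross v) (fun m' => by
    rcases eq_or_ne m' m with rfl | h
    · simpa using horth
    · simpa [h] using sum_mul_multiCross_self v m') hv0
  rcases powErr_le_of_parallel ζ hk hl hkl with ⟨h0, -⟩ | ⟨-, h⟩
  · exact h1 X hXX₁ _ hv0 (h0.trans hsmall) hc2
  · exact h1 X hXX₁ _ hm hsmall fun i => (h i).trans (hc2 i)

lemma whExp_four_eq (hζ : Transcendental ℚ ζ) : whExp 4 ζ = 4 := by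
  have hup : ∀ η ∈ whSet 4 ζ, η ≤ 4 := fun η h => by
    by_contra! h4
    exact not_uniform_linVal hw hlow hfour h4 (exists_vec_of_mem_whSet h)
  have hmem : ∀ η < 4, η ∈ whSet 4 ζ := fun η h => by
    obtain ⟨X₀, h⟩ := dirichlet_linVal ζ 4 (η := η) (by exact_mod_cast h)
    exact mem_whSet_of_exists_vec hζ h
  refine le_antisymm (csSup_le ⟨0, hmem 0 (by norm_num)⟩ hup) ?_
  exact le_of_forall_lt fun η h => by
    obtain ⟨η', h1, h2⟩ := exists_between h
    exact h1.trans_le (le_csSup ⟨4, hup⟩ (hmem η' h2))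

lemma lamhExp_four_eq : lamhExp 4 ζ = 1 / 4 := by
  have hup : ∀ η ∈ lamhSet 4 ζ, η ≤ 1 / 4 := fun η ⟨X₀, h⟩ => by
    by_contra! h4
    refine not_uniform_powErr hw hlow hfour h4 ⟨max X₀ 1, fun Y hY => ?_⟩
    obtain ⟨x, y, h0, hx, hy⟩ := h Y ((le_max_left _ _).trans hY)
    have hY1 : 1 ≤ Y := (le_max_right _ _).trans hY
    refine ⟨Fin.cons x y, ?_, by simpa using hx, fun i => ?_⟩
    · intro hc
      have hx0 : x = 0 := by simpa using congrFun hc 0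
      have hy0 : y = 0 := funext fun i => by simpa using congrFun hc i.succ
      tauto
    · refine Fin.cases ?_ (fun i => ?_) i
      · simp only [powErr, Fin.val_zero, pow_zero, one_mul, sub_self, abs_zero]
        positivity
      · simpa [powErr] using hy i
  have hmem : ∀ η < 1 / 4, η ∈ lamhSet 4 ζ := fun η h => by
    obtain ⟨X₀, h⟩ := dirichlet_powErr ζ 4 (by norm_num) (η := η) (by exact_mod_cast h)
    refine ⟨X₀, fun Y hY => ?_⟩
    obtain ⟨x, hx, hxY, hxE⟩ := h Y hY
    refine ⟨x 0, fun i => x i.succ, ?_, by simpa using hxY, fun i => ?_⟩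
    · by_contra! hc
      apply hx
      funext i
      exact Fin.cases hc.1 (fun i => congrFun hc.2 i) i
    · simpa [powErr] using hxE i.succ
  refine le_antisymm (csSup_le ⟨0, hmem 0 (by norm_num)⟩ hup) ?_
  exact le_of_forall_lt fun η h => by
    obtain ⟨η', h1, h2⟩ := exists_between h
    exact h1.trans_le (le_csSup ⟨1 / 4, hup⟩ (hmem η' h2))

end Four

/-- Two integer vectors are parallel if all their `2 × 2` minors vanish. -/
def Par {n : ℕ} (p q : Fin n → ℤ) : Prop := ∀ i j, p i * q j = p j * q i

lemma Par.refl {n : ℕ} (p : Fin n → ℤ) : Par p p := fun _ _ => mul_comm _ _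

lemma Par.symm {n : ℕ} {p q : Fin n → ℤ} (h : Par p q) : Par q p := fun i j => by
  linarith [h i j]

lemma Par.exists_mul_eq {n : ℕ} {p q : Fin n → ℤ} (h : Par p q) (hp : p ≠ 0) (hq : q ≠ 0) :
    ∃ k l : ℤ, k ≠ 0 ∧ l ≠ 0 ∧ ∀ i, k * q i = l * p i := by
  obtain ⟨j, hj⟩ := Function.ne_iff.1 hp
  obtain ⟨i, hi⟩ := Function.ne_iff.1 hq
  refine ⟨p j, q j, hj, fun h0 => ?_, fun i => by linarith [h i j]⟩
  have := h i j
  rw [h0, mul_zero] at this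
  exact (mul_ne_zero hj hi) this.symm

lemma Par.trans {n : ℕ} {p q r : Fin n → ℤ} (h : Par p q) (h' : Par q r) (hq : q ≠ 0) : Par p r := by
  obtain ⟨k, hk⟩ := Function.ne_iff.1 hq
  have hk : q k ≠ 0 := hk
  intro i j
  refine mul_left_cancel₀ (mul_ne_zero hk hk) ?_
  linear_combination (q k * r j) * h i k + p k * q i * h' k j - p k * q j * h' k i -
    (q k * r i) * h j k

lemma Par.mul_linVal (ζ : ℝ) {n : ℕ} {p q : Fin n → ℤ} (h : Par p q) (i : Fin n) :
    (p i : ℝ) * linVal ζ q = q i * linVal ζ p := by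
  rw [linVal, linVal, Finset.mul_sum, Finset.mul_sum]
  refine Finset.sum_congr rfl fun j _ => ?_
  have : (p i : ℝ) * q j = p j * q i := by exact_mod_cast h i j
  linear_combination ζ ^ (j : ℕ) * this

lemma linVal_sub (ζ : ℝ) {n : ℕ} (p q : Fin n → ℤ) : linVal ζ (p - q) = linVal ζ p - linVal ζ q := by
  simp [linVal, sub_mul, Finset.sum_sub_distrib]

lemma linVal_add (ζ : ℝ) {n : ℕ} (p q : Fin n → ℤ) : linVal ζ (p + q) = linVal ζ p + linVal ζ q := by
  simp [linVal, add_mul, Finset.sum_add_distrib]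

lemma par_of_abs_linVal_eq {ζ : ℝ} (hζ : Transcendental ℚ ζ) {n : ℕ} {p q : Fin n → ℤ}
    (h : |linVal ζ p| = |linVal ζ q|) : Par p q := by
  rcases abs_eq_abs.1 h with h | h
  · have : p - q = 0 := by
      by_contra hne
      exact linVal_ne_zero hζ hne (by rw [linVal_sub, h, sub_self])
    rw [sub_eq_zero.1 this]
    exact Par.refl q
  · have : p + q = 0 := by
      by_contra hne
      exact linVal_ne_zero hζ hne (by rw [linVal_add, h, neg_add_cancel])
    rw [eq_neg_of_add_eq_zero_left this]
    exact fun i j => by simp [mul_comm]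

lemma multiCross_two (p q : Fin (2 + 1) → ℤ) :
    multiCross ![p, q] = ![p 1 * q 2 - p 2 * q 1, p 2 * q 0 - p 0 * q 2, p 0 * q 1 - p 1 * q 0] := by
  funext i
  fin_cases i <;> simp [multiCross, Matrix.det_fin_two, Fin.succAbove]

lemma par_of_multiCross_eq_zero {p q : Fin (2 + 1) → ℤ} (h : multiCross ![p, q] = 0) : Par p q := by
  rw [multiCross_two] at h
  have h0 := congrFun h 0
  have h1 := congrFun h 1
  have h2 := congrFun h 2
  simp at h0 h1 h2
  intro i j
  fin_cases i <;> fin_cases j <;> simp <;> linarith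

lemma exists_minimal_vec (ζ : ℝ) (n N : ℕ) (hN : 1 ≤ N) :
    ∃ p : Fin (n + 1) → ℤ, p ≠ 0 ∧ (∀ i, |(p i : ℝ)| ≤ N) ∧
      ∀ q : Fin (n + 1) → ℤ, q ≠ 0 → (∀ i, |(q i : ℝ)| ≤ N) → |linVal ζ p| ≤ |linVal ζ q| := by
  classical
  set s : Finset (Fin (n + 1) → ℤ) :=
    (Fintype.piFinset fun _ => Finset.Icc (-(N : ℤ)) N).filter (· ≠ 0) with hs
  have hmem : ∀ p : Fin (n + 1) → ℤ, p ∈ s ↔ (∀ i, |(p i : ℝ)| ≤ N) ∧ p ≠ 0 := by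
    intro p
    simp only [hs, Finset.mem_filter, Fintype.mem_piFinset, Finset.mem_Icc, ← abs_le]
    norm_cast
  have hne : s.Nonempty := ⟨fun _ => 1, (hmem _).2 ⟨fun i => by simpa using hN,
    fun h => by simpa using congrFun h 0⟩⟩
  obtain ⟨p, hp, hmin⟩ := s.exists_min_image (fun p => |linVal ζ p|) hne
  rw [hmem] at hp
  exact ⟨p, hp.2, hp.1, fun q hq hqN => hmin q ((hmem q).2 ⟨hqN, hq⟩)⟩

/-- The integral binary quadratic form attached to `p` has no nontrivial integral zero. -/
def Aniso (p : Fin (2 + 1) → ℤ) : Prop :=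
  ∀ a b : ℤ, p 0 * b ^ 2 + p 1 * a * b + p 2 * a ^ 2 = 0 → a = 0 ∧ b = 0

lemma Aniso.disc_ne_zero {p x : Fin (2 + 1) → ℤ} (hp : Aniso p) (hx : x ≠ 0)
    (h : ∑ i, p i * x i = 0) : x 0 * x 2 - x 1 ^ 2 ≠ 0 := by
  intro hd
  have h' : p 0 * x 0 + p 1 * x 1 + p 2 * x 2 = 0 := by
    rw [Fin.sum_univ_three] at h
    exact h
  have h1 := hp (x 1) (x 0) (by linear_combination x 0 * h' - p 2 * hd)
  have h2 := hp (x 2) (x 1) (by linear_combination x 2 * h' - p 0 * hd)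
  apply hx
  funext i
  fin_cases i
  exacts [h1.2, h1.1, h2.1]

lemma one_le_of_disc_ne_zero (ζ : ℝ) {x : Fin (2 + 1) → ℤ} {Z E : ℝ}
    (hd : x 0 * x 2 - x 1 ^ 2 ≠ 0) (hZ : |(x 0 : ℝ)| ≤ Z) (hE : ∀ i, |powErr ζ x i| ≤ E) :
    1 ≤ Z * (1 + 2 * |ζ|) * E + E ^ 2 := by
  have h1 : (1 : ℝ) ≤ |((x 0 * x 2 - x 1 ^ 2 : ℤ) : ℝ)| := by
    rw [← Int.cast_abs]
    exact_mod_cast Int.one_le_abs hd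
  have e1 := hE 1
  have e2 := hE 2
  set d1 := powErr ζ x 1 with hd1
  set d2 := powErr ζ x 2 with hd2
  have e : ((x 0 * x 2 - x 1 ^ 2 : ℤ) : ℝ) = -(x 0 * d2) + 2 * (x 0 * ζ * d1) - d1 ^ 2 := by
    rw [hd1, hd2, powErr, powErr]
    push_cast
    simp
    ring
  have hE0 : 0 ≤ E := (abs_nonneg _).trans e1
  have hZ0 : 0 ≤ Z := (abs_nonneg _).trans hZ
  have b1 : |(x 0 : ℝ) * d2| ≤ Z * E := by rw [abs_mul]; gcongr
  have b2 : |(x 0 : ℝ) * ζ * d1| ≤ Z * |ζ| * E := by rw [abs_mul, abs_mul]; gcongr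
  have b3 : d1 ^ 2 ≤ E ^ 2 := by rw [← sq_abs d1]; gcongr
  rw [e] at h1
  rw [abs_le] at b1 b2
  have : |-((x 0 : ℝ) * d2) + 2 * (x 0 * ζ * d1) - d1 ^ 2| ≤ Z * (1 + 2 * |ζ|) * E + E ^ 2 := by
    rw [abs_le]
    constructor <;> linarith [b1.1, b1.2, b2.1, b2.2, sq_nonneg d1]
  linarith

lemma one_le_of_parallel (ζ : ℝ) {x y : Fin (2 + 1) → ℤ} {k l : ℤ} (hk : k ≠ 0) (hl : l ≠ 0)
    (h : ∀ i, k * y i = l * x i) {Z E : ℝ} (hd : x 0 * x 2 - x 1 ^ 2 ≠ 0) (hZ : |(x 0 : ℝ)| ≤ Z)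
    (hE : ∀ i, |powErr ζ y i| ≤ E) : 1 ≤ Z * (1 + 2 * |ζ|) * E + E ^ 2 := by
  rcases powErr_le_of_parallel ζ hk hl h with ⟨h0, -⟩ | ⟨-, h1⟩
  · refine one_le_of_disc_ne_zero ζ (fun hd' => hd ?_) (h0.trans hZ) hE
    have : l ^ 2 * (x 0 * x 2 - x 1 ^ 2) = k ^ 2 * (y 0 * y 2 - y 1 ^ 2) := by
      linear_combination -(k * y 2) * h 0 - l * x 0 * h 2 + (k * y 1 + l * x 1) * h 1
    rw [hd', mul_zero] at this
    exact (mul_eq_zero.1 this).resolve_left (pow_ne_zero 2 hl)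
  · exact one_le_of_disc_ne_zero ζ hd hZ fun i => (h1 i).trans (hE i)

lemma linVal_three (ζ : ℝ) (p : Fin (2 + 1) → ℤ) : linVal ζ p = p 0 + p 1 * ζ + p 2 * ζ ^ 2 := by
  rw [linVal, Fin.sum_univ_three]
  simp

/-- A form with coefficients smaller than `max |a| |b|` does not vanish at a primitive `(a, b)`. -/
lemma eq_zero_of_form_eq_zero {a b : ℤ} (hab : IsCoprime a b) {s : Fin (2 + 1) → ℤ}
    (hs : ∀ i, |s i| < max |a| |b|) (h : s 0 * b ^ 2 + s 1 * a * b + s 2 * a ^ 2 = 0) : s = 0 := by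
  have key : ∀ {a b r t u : ℤ}, IsCoprime a b → |r| < |a| → |t| < |a| →
      r * b ^ 2 + t * a * b + u * a ^ 2 = 0 → r = 0 ∧ t = 0 ∧ u = 0 := by
    intro a b r t u hab hr ht h
    have ha : a ≠ 0 := fun ha => by
      rw [ha, abs_zero] at hr
      exact absurd hr (not_lt.2 (abs_nonneg _))
    have hr0 : r = 0 := by
      refine Int.eq_zero_of_abs_lt_dvd (m := |a|) ?_ hr
      rw [abs_dvd]
      refine (hab.pow_right (n := 2)).dvd_of_dvd_mul_right (y := r) ⟨-(t * b + u * a), ?_⟩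
      linear_combination h
    have h1 : t * b + u * a = 0 := by
      refine mul_left_cancel₀ ha ?_
      linear_combination h - b ^ 2 * hr0
    have ht0 : t = 0 := by
      refine Int.eq_zero_of_abs_lt_dvd (m := |a|) ?_ ht
      rw [abs_dvd]
      exact hab.dvd_of_dvd_mul_right (y := t) ⟨-u, by linear_combination h1⟩
    refine ⟨hr0, ht0, ?_⟩
    rw [ht0, zero_mul, zero_add] at h1
    exact (mul_eq_zero.1 h1).resolve_right ha
  have h3 : s 0 = 0 ∧ s 1 = 0 ∧ s 2 = 0 := by
    rcases le_total |b| |a| with hle | hle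
    · rw [max_eq_left hle] at hs
      exact key hab (hs 0) (hs 1) h
    · rw [max_eq_right hle] at hs
      obtain ⟨h2, h1, h0⟩ := key hab.symm (hs 2) (hs 1) (u := s 0) (by linear_combination h)
      exact ⟨h0, h1, h2⟩
  funext i
  fin_cases i
  exacts [h3.1, h3.2.1, h3.2.2]

lemma exists_isCoprime_mul {a b : ℤ} (h : a ≠ 0 ∨ b ≠ 0) :
    ∃ g a' b' : ℤ, g ≠ 0 ∧ IsCoprime a' b' ∧ a = g * a' ∧ b = g * b' := by
  have hg : 0 < Int.gcd a b := by
    rw [Nat.pos_iff_ne_zero, Ne, Int.gcd_eq_zero_iff]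
    tauto
  obtain ⟨a', b', h1, ha, hb⟩ := Int.exists_gcd_one hg
  exact ⟨Int.gcd a b, a', b', by exact_mod_cast hg.ne', Int.isCoprime_iff_gcd_eq_one.2 h1,
    by rw [mul_comm, ← ha], by rw [mul_comm, ← hb]⟩

/-- If the uniform exponent in degree two exceeds two, the number is not too well approximable by
rational numbers. -/
lemma exists_linear_lower_bound {ζ : ℝ} (hζ : Transcendental ℚ ζ) {η : ℝ} (hη : 2 < η)
    (h : η ∈ whSet 2 ζ) : ∃ c : ℝ, 0 < c ∧ ∀ a b : ℤ, (a ≠ 0 ∨ b ≠ 0) →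
      c ≤ |b * ζ - a| * (max |(a : ℝ)| |(b : ℝ)|) ^ 2 := by
  obtain ⟨X₀, hX₀⟩ := exists_vec_of_mem_whSet h
  obtain ⟨X₁, hX₁, h1⟩ := exists_forall_mul_rpow_le_one 8 (a := -η + 2) (by linarith)
  set B : ℕ := ⌈2 * max X₀ X₁⌉₊ + 1 with hB
  obtain ⟨p, hp0, hpB, hpmin⟩ := exists_minimal_vec ζ 1 B (by omega)
  have hB' : 2 * max X₀ X₁ ≤ B := (Nat.le_ceil _).trans (by rw [hB]; push_cast; linarith)
  have hc1 : 0 < |linVal ζ p| := abs_pos.2 (linVal_ne_zero hζ hp0)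
  have hprim : ∀ a b : ℤ, IsCoprime a b →
      min |linVal ζ p| (1 / (2 + |ζ|)) ≤ |b * ζ - a| * (max |(a : ℝ)| |(b : ℝ)|) ^ 2 := by
    intro a b hab
    set m : ℝ := max |(a : ℝ)| |(b : ℝ)| with hm
    have ham : |(a : ℝ)| ≤ m := le_max_left _ _
    have hbm : |(b : ℝ)| ≤ m := le_max_right _ _
    have hm' : m = ((max |a| |b| : ℤ) : ℝ) := by push_cast; rfl
    have hm1 : 1 ≤ m := by
      rcases (or_iff_not_and_not.2 fun hz => not_isCoprime_zero_zero (R := ℤ)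
        (by simpa [not_not.1 hz.1, not_not.1 hz.2] using hab) : a ≠ 0 ∨ b ≠ 0) with h0 | h0
      · refine le_trans ?_ ham
        rw [← Int.cast_abs]
        exact_mod_cast Int.one_le_abs h0
      · refine le_trans ?_ hbm
        rw [← Int.cast_abs]
        exact_mod_cast Int.one_le_abs h0
    rcases le_or_gt m B with hmB | hmB
    · have := hpmin ![-a, b] (fun h0 => by
        have h1 := congrFun h0 0
        have h2 := congrFun h0 1
        simp at h1 h2
        subst h1 h2
        exact not_isCoprime_zero_zero hab) (fun i => by
          fin_cases i
          · simpa using ham.trans hmB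
          · simpa using hbm.trans hmB)
      have e : linVal ζ ![-a, b] = b * ζ - a := by
        simp [linVal, Fin.sum_univ_two]
        ring
      rw [e] at this
      refine (min_le_left _ _).trans (this.trans ?_)
      exact le_mul_of_one_le_right (abs_nonneg _) (one_le_pow₀ hm1)
    · have hY : max X₀ X₁ ≤ m / 2 := by linarith
      obtain ⟨s, hs0, hsY, hsv⟩ := hX₀ (m / 2) ((le_max_left _ _).trans hY)
      have e1 := h1 (m / 2) ((le_max_right _ _).trans hY)
      rw [Real.rpow_add (by positivity), Real.rpow_two] at e1
      have hne : s 0 * b ^ 2 + s 1 * a * b + s 2 * a ^ 2 ≠ 0 := fun h0 => by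
        refine hs0 (eq_zero_of_form_eq_zero hab (fun i => ?_) h0)
        have : |(s i : ℝ)| < m := (hsY i).trans_lt (by linarith)
        rw [hm', ← Int.cast_abs] at this
        exact_mod_cast this
      have h2 : (1 : ℝ) ≤ |((s 0 * b ^ 2 + s 1 * a * b + s 2 * a ^ 2 : ℤ) : ℝ)| := by
        rw [← Int.cast_abs]
        exact_mod_cast Int.one_le_abs hne
      have e : ((s 0 * b ^ 2 + s 1 * a * b + s 2 * a ^ 2 : ℤ) : ℝ) =
          b ^ 2 * linVal ζ s - (b * ζ - a) * (s 1 * b + s 2 * (b * ζ + a)) := by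
        rw [linVal_three]
        push_cast
        ring
      have h3 : |(s 1 : ℝ) * b + s 2 * (b * ζ + a)| ≤ m / 2 * (m * (2 + |ζ|)) := by
        have i1 : |(s 1 : ℝ) * b| ≤ m / 2 * m := by
          rw [abs_mul]
          exact mul_le_mul (hsY 1) hbm (abs_nonneg _) (by positivity)
        have i2 : |(b : ℝ) * ζ + a| ≤ m * |ζ| + m := by
          refine (abs_add_le _ _).trans ?_
          rw [abs_mul]
          gcongr
        have i3 : |(s 2 : ℝ) * (b * ζ + a)| ≤ m / 2 * (m * |ζ| + m) := by
          rw [abs_mul]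
          exact mul_le_mul (hsY 2) i2 (abs_nonneg _) (by positivity)
        refine (abs_add_le _ _).trans ?_
        linarith
      have h4 : |(b : ℝ) ^ 2 * linVal ζ s| ≤ m ^ 2 * (m / 2) ^ (-η) := by
        rw [abs_mul, abs_pow]
        gcongr
      have h5 : |(b * ζ - a) * (s 1 * b + s 2 * (b * ζ + a))| ≤
          |b * ζ - a| * (m / 2 * (m * (2 + |ζ|))) := by
        rw [abs_mul]
        gcongr
      rw [e] at h2
      have h6 := h2.trans (abs_sub _ _)
      refine (min_le_right _ _).trans ?_
      rw [div_le_iff₀ (by positivity)]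
      linarith
  refine ⟨min |linVal ζ p| (1 / (2 + |ζ|)), lt_min hc1 (by positivity), fun a b hab => ?_⟩
  obtain ⟨g, a', b', hg, hco, rfl, rfl⟩ := exists_isCoprime_mul hab
  refine (hprim a' b' hco).trans ?_
  have hg1 : 1 ≤ |(g : ℝ)| := by
    rw [← Int.cast_abs]
    exact_mod_cast Int.one_le_abs hg
  have e : ((g * b' : ℤ) : ℝ) * ζ - ((g * a' : ℤ) : ℝ) = g * (b' * ζ - a') := by push_cast; ring
  rw [e, abs_mul]
  have e1 : |(a' : ℝ)| ≤ |((g * a' : ℤ) : ℝ)| := by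
    push_cast
    rw [abs_mul]
    exact le_mul_of_one_le_left (abs_nonneg _) hg1
  have e2 : |(b' : ℝ)| ≤ |((g * b' : ℤ) : ℝ)| := by
    push_cast
    rw [abs_mul]
    exact le_mul_of_one_le_left (abs_nonneg _) hg1
  gcongr
  exact le_mul_of_one_le_left (abs_nonneg _) hg1

/-- A weak form of Gelfond's inequality for a product of two linear polynomials. -/
lemma max_mul_max_le {a b c d N : ℝ} (h0 : |a * d| ≤ N) (h1 : |b * d - a * c| ≤ N)
    (h2 : |b * c| ≤ N) : max |a| |b| * max |c| |d| ≤ 2 * N := by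
  have hN : 0 ≤ N := (abs_nonneg _).trans h0
  have h3 : |a * c| * |b * d| ≤ N * N := by
    have : |a * c| * |b * d| = |a * d| * |b * c| := by
      rw [abs_mul, abs_mul, abs_mul, abs_mul]
      ring
    rw [this]
    gcongr
  have h4 : |a * c| - |b * d| ≤ N ∧ |b * d| - |a * c| ≤ N := by
    have := (abs_abs_sub_abs_le_abs_sub (b * d) (a * c)).trans h1
    rw [abs_le] at this
    constructor <;> linarith [this.1, this.2]
  have h5 : |a * c| ≤ 2 * N := by
    by_contra! h
    nlinarith [h4.1]
  have h6 : |b * d| ≤ 2 * N := by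
    by_contra! h
    nlinarith [h4.2]
  rcases max_choice |a| |b| with e | e <;> rcases max_choice |c| |d| with e' | e' <;> rw [e, e', ← abs_mul] <;>
    linarith

lemma exists_factor_of_form_eq_zero {a b : ℤ} (hab : IsCoprime a b) {p : Fin (2 + 1) → ℤ}
    (h : p 0 * b ^ 2 + p 1 * a * b + p 2 * a ^ 2 = 0) :
    ∃ c d : ℤ, p 0 = -(a * d) ∧ p 1 = b * d - a * c ∧ p 2 = b * c := by
  by_cases ha : a = 0
  · subst ha
    have hb : IsUnit b := isCoprime_zero_left.1 hab
    have hbb : b * b = 1 := Int.isUnit_mul_self hb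
    refine ⟨b * p 2, b * p 1, ?_, ?_, ?_⟩
    · linear_combination h - p 0 * hbb
    · linear_combination -p 1 * hbb
    · linear_combination -p 2 * hbb
  by_cases hb : b = 0
  · subst hb
    have hb : IsUnit a := isCoprime_zero_right.1 hab
    have hbb : a * a = 1 := Int.isUnit_mul_self hb
    refine ⟨-(a * p 1), -(a * p 0), ?_, ?_, ?_⟩
    · linear_combination -p 0 * hbb
    · linear_combination -p 1 * hbb
    · linear_combination h - p 2 * hbb
  obtain ⟨d, hd⟩ : a ∣ p 0 := (hab.pow_right (n := 2)).dvd_of_dvd_mul_right (y := p 0)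
    ⟨-(p 1 * b + p 2 * a), by linear_combination h⟩
  have h1 : d * b ^ 2 + p 1 * b + p 2 * a = 0 := by
    refine mul_left_cancel₀ ha ?_
    linear_combination h - b ^ 2 * hd
  obtain ⟨c, hc⟩ : b ∣ p 2 := hab.symm.dvd_of_dvd_mul_right (y := p 2)
    ⟨-(d * b + p 1), by linear_combination h1⟩
  refine ⟨c, -d, by linear_combination hd, ?_, hc⟩
  refine mul_left_cancel₀ hb ?_
  linear_combination h1 - a * hc

lemma exists_aniso {ζ : ℝ} (hζ : Transcendental ℚ ζ) {η : ℝ} (hη : 2 < η) (h : η ∈ whSet 2 ζ) :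
    ∃ X₀ : ℝ, ∀ Y, X₀ ≤ Y → ∀ p : Fin (2 + 1) → ℤ, p ≠ 0 → (∀ i, |(p i : ℝ)| ≤ Y) →
      |linVal ζ p| ≤ Y ^ (-η) → Aniso p := by
  obtain ⟨c₀, hc₀, hc⟩ := exists_linear_lower_bound hζ hη h
  obtain ⟨X₁, hX₁, h1⟩ := exists_forall_mul_rpow_le_one (8 / c₀ ^ 2) (a := -η + 2) (by linarith)
  refine ⟨X₁, fun Y hY p hp hpY hpv a b hab => ?_⟩
  by_contra hne
  have hne' : a ≠ 0 ∨ b ≠ 0 := by tauto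
  obtain ⟨g, a', b', hg, hco, rfl, rfl⟩ := exists_isCoprime_mul hne'
  have hform : p 0 * b' ^ 2 + p 1 * a' * b' + p 2 * a' ^ 2 = 0 := by
    refine mul_left_cancel₀ (pow_ne_zero 2 hg) ?_
    linear_combination hab
  obtain ⟨c, d, hp0, hp1, hp2⟩ := exists_factor_of_form_eq_zero hco hform
  have hab' : a' ≠ 0 ∨ b' ≠ 0 := by
    by_contra! hz
    rw [hz.1, hz.2] at hco
    exact not_isCoprime_zero_zero hco
  have hcd : -d ≠ 0 ∨ c ≠ 0 := by
    by_contra! hz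
    apply hp
    have hd : d = 0 := by simpa using hz.1
    rw [hd, hz.2] at hp1
    rw [hd] at hp0
    rw [hz.2] at hp2
    funext i
    fin_cases i
    · simpa using hp0
    · simpa using hp1
    · simpa using hp2
  have l1 := hc a' b' hab'
  have l2 := hc (-d) c hcd
  have hval : linVal ζ p = (b' * ζ - a') * (c * ζ - ((-d : ℤ) : ℝ)) := by
    rw [linVal_three, hp0, hp1, hp2]
    push_cast
    ring
  have hmax : max |(a' : ℝ)| |(b' : ℝ)| * max |(c : ℝ)| |(d : ℝ)| ≤ 2 * Y := by
    have i0 := hpY 0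
    have i1 := hpY 1
    have i2 := hpY 2
    rw [hp0] at i0
    rw [hp1] at i1
    rw [hp2] at i2
    push_cast at i0 i1 i2
    rw [abs_neg] at i0
    exact max_mul_max_le i0 i1 i2
  have e1 : max |((-d : ℤ) : ℝ)| |(c : ℝ)| = max |(c : ℝ)| |(d : ℝ)| := by
    rw [max_comm]
    push_cast
    rw [abs_neg]
  rw [e1] at l2
  have hY0 : 0 < Y := by linarith
  have l3 : c₀ ^ 2 ≤ Y ^ (-η) * (2 * Y) ^ 2 := by
    calc c₀ ^ 2 = c₀ * c₀ := sq _
      _ ≤ (|b' * ζ - a'| * (max |(a' : ℝ)| |(b' : ℝ)|) ^ 2) *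
          (|c * ζ - ((-d : ℤ) : ℝ)| * (max |(c : ℝ)| |(d : ℝ)|) ^ 2) := by gcongr
      _ = |linVal ζ p| * (max |(a' : ℝ)| |(b' : ℝ)| * max |(c : ℝ)| |(d : ℝ)|) ^ 2 := by
        rw [hval, abs_mul]
        ring
      _ ≤ Y ^ (-η) * (2 * Y) ^ 2 := by gcongr
  have l4 := h1 Y hY
  rw [Real.rpow_add hY0, Real.rpow_two, div_mul_eq_mul_div, div_le_one (by positivity)] at l4
  nlinarith

/-- `f N` is a best approximation of height at most `N`, for all `N ≥ N₀`. -/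
structure MinSeq (ζ η ω : ℝ) (f : ℕ → Fin (2 + 1) → ℤ) (N₀ : ℕ) : Prop where
  one_le : 1 ≤ N₀
  transcendental : Transcendental ℚ ζ
  ne_zero : ∀ N, N₀ ≤ N → f N ≠ 0
  height : ∀ N, N₀ ≤ N → ∀ i, |(f N i : ℝ)| ≤ N
  val_le : ∀ N, N₀ ≤ N → |linVal ζ (f N)| ≤ (N : ℝ) ^ (-η)
  minimal : ∀ N, N₀ ≤ N → ∀ q : Fin (2 + 1) → ℤ, q ≠ 0 → (∀ i, |(q i : ℝ)| ≤ N) →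
    |linVal ζ (f N)| ≤ |linVal ζ q|
  aniso : ∀ N, N₀ ≤ N → Aniso (f N)
  lt_val : ∀ N, N₀ ≤ N → ∀ p : Fin (2 + 1) → ℤ, p ≠ 0 → (∀ i, |(p i : ℝ)| ≤ N) →
    (N : ℝ) ^ (-ω) < |linVal ζ p|

lemma exists_minSeq {ζ : ℝ} (hζ : Transcendental ℚ ζ) {η ω : ℝ} (hη : 2 < η)
    (h : η ∈ whSet 2 ζ) (hω : ω ∉ wSet 4 ζ) : ∃ f N₀, MinSeq ζ η ω f N₀ := by
  obtain ⟨X₀, h0⟩ := exists_vec_of_mem_whSet h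
  obtain ⟨X₁, hX₁, h1⟩ := lt_abs_linVal_of_notMem_wSet (k := 2) hζ (by norm_num) hω
  obtain ⟨X₂, h2⟩ := exists_aniso hζ hη h
  choose! f hf0 hfN hfmin using exists_minimal_vec ζ 2
  set N₀ : ℕ := ⌈max X₀ (max X₁ X₂)⌉₊ + 1 with hN₀
  have hle : ∀ N : ℕ, N₀ ≤ N → X₀ ≤ N ∧ X₁ ≤ N ∧ X₂ ≤ N := fun N hN => by
    have : max X₀ (max X₁ X₂) ≤ N := (Nat.le_ceil _).trans (by exact_mod_cast (by omega))
    simpa [max_le_iff] using this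
  have hN1 : ∀ N : ℕ, N₀ ≤ N → 1 ≤ N := fun N hN => by omega
  have hval : ∀ N, N₀ ≤ N → |linVal ζ (f N)| ≤ (N : ℝ) ^ (-η) := fun N hN => by
    obtain ⟨p, hp0, hpN, hpv⟩ := h0 N (hle N hN).1
    exact (hfmin N (hN1 N hN) p hp0 hpN).trans hpv
  exact ⟨f, N₀, by omega, hζ, fun N hN => hf0 N (hN1 N hN), fun N hN => hfN N (hN1 N hN), hval,
    fun N hN => hfmin N (hN1 N hN),
    fun N hN => h2 N (hle N hN).2.2 _ (hf0 N (hN1 N hN)) (hfN N (hN1 N hN)) (hval N hN),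
    fun N hN => h1 N (hle N hN).2.1⟩

lemma abs_det_three_le (ζ : ℝ) {p q r : Fin (2 + 1) → ℤ} {P Q R V : ℝ} (hQ : 0 < Q) (hQR : Q ≤ R)
    (hPQ : P ≤ Q)
    (hp : ∀ i, |(p i : ℝ)| ≤ P) (hq : ∀ i, |(q i : ℝ)| ≤ Q) (hr : ∀ i, |(r i : ℝ)| ≤ R)
    (vp : |linVal ζ p| ≤ V) (vq : |linVal ζ q| ≤ V) (vr : |linVal ζ r| ≤ V) :
    |((∑ i, p i * multiCross ![q, r] i : ℤ) : ℝ)| ≤ 20 * (Q * R * V) := by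
  have hV : 0 ≤ V := (abs_nonneg _).trans vp
  have hR : 0 < R := hQ.trans_le hQR
  have ha : ∀ m i, |((![q, r] : Fin 2 → Fin (2 + 1) → ℤ) m i : ℝ)| ≤ (![Q, R] : Fin 2 → ℝ) m := by
    intro m i
    fin_cases m
    exacts [hq i, hr i]
  have h1 := abs_multiCross_zero_le ha
  have h2 := abs_powErr_multiCross_le ζ (θ := V / Q) (by positivity) ha (fun m => by
    fin_cases m
    · simpa [mul_div_cancel₀ _ hQ.ne'] using vq
    · refine vr.trans ?_
      simp only [Fin.mk_one, Matrix.cons_val_one, Matrix.cons_val_fin_one]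
      rw [mul_div_assoc', le_div_iff₀ hQ, mul_comm]
      gcongr)
  have h3 := linVal_mul_sub_sum ζ p (multiCross ![q, r])
  have h4 := abs_sum_mul_powErr_le ζ (fun i => (hp i).trans hPQ) h2
  have h5 : |linVal ζ p * (multiCross ![q, r] 0 : ℤ)| ≤ V * (2 * (Q * R)) := by
    rw [abs_mul]
    simp [Fin.prod_univ_two] at h1
    gcongr
  have h6 : ((2 : ℕ) + 1 : ℝ) * (Q * ((2 + 1).factorial * ((∏ m, (![Q, R] : Fin 2 → ℝ) m) * (V / Q)))) =
      18 * (Q * R * V) := by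
    simp [Fin.prod_univ_two, Nat.factorial]
    field_simp
    norm_num
    ring
  rw [h6] at h4
  have h7 : ((∑ i, p i * multiCross ![q, r] i : ℤ) : ℝ) = linVal ζ p * (multiCross ![q, r] 0 : ℤ) -
      ∑ i, (p i : ℝ) * powErr ζ (multiCross ![q, r]) i := by rw [← h3]; ring
  rw [h7]
  exact (abs_sub _ _).trans (by linarith)

namespace MinSeq

variable {ζ η ω : ℝ} {f : ℕ → Fin (2 + 1) → ℤ} {N₀ : ℕ}

lemma val_anti (hf : MinSeq ζ η ω f N₀) {M N : ℕ} (hM : N₀ ≤ M) (hMN : M ≤ N) :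
    |linVal ζ (f N)| ≤ |linVal ζ (f M)| :=
  hf.minimal N (hM.trans hMN) _ (hf.ne_zero M hM) fun i =>
    (hf.height M hM i).trans (by exact_mod_cast hMN)

lemma val_pos (hf : MinSeq ζ η ω f N₀) {N : ℕ} (hN : N₀ ≤ N) : 0 < |linVal ζ (f N)| :=
  abs_pos.2 (linVal_ne_zero hf.transcendental (hf.ne_zero N hN))

lemma val_eq_of_par (hf : MinSeq ζ η ω f N₀) {M N : ℕ} (hM : N₀ ≤ M) (hMN : M ≤ N)
    (h : Par (f M) (f N)) : |linVal ζ (f N)| = |linVal ζ (f M)| := by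
  refine le_antisymm (hf.val_anti hM hMN) (hf.minimal M hM _ (hf.ne_zero N (hM.trans hMN)) fun i => ?_)
  have h1 : |(f N i : ℝ)| * |linVal ζ (f M)| = |(f M i : ℝ)| * |linVal ζ (f N)| := by
    rw [← abs_mul, ← abs_mul, h.mul_linVal ζ i]
  have h2 : |(f N i : ℝ)| * |linVal ζ (f M)| ≤ |(f M i : ℝ)| * |linVal ζ (f M)| := by
    rw [h1]
    exact mul_le_mul_of_nonneg_left (hf.val_anti hM hMN) (abs_nonneg _)
  exact (le_of_mul_le_mul_right h2 (hf.val_pos hM)).trans (hf.height M hM i)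

lemma exists_jump (hf : MinSeq ζ η ω f N₀) (hη : 0 < η) (N : ℕ) (hN : N₀ ≤ N) :
    ∃ n, N ≤ n ∧ ¬ Par (f n) (f (n + 1)) := by
  by_contra! h
  have hpar : ∀ n, N ≤ n → Par (f N) (f n) := by
    intro n hn
    induction n, hn using Nat.le_induction with
    | base => exact Par.refl _
    | succ n hn ih => exact ih.trans (h n hn) (hf.ne_zero n (hN.trans hn))
  have hlim : Filter.Tendsto (fun n : ℕ => (n : ℝ) ^ (-η)) Filter.atTop (nhds 0) :=
    (tendsto_rpow_neg_atTop hη).comp tendsto_natCast_atTop_atTop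
  obtain ⟨n, hn1, hn2⟩ := ((hlim.eventually_lt_const (hf.val_pos hN)).and
    (Filter.eventually_ge_atTop N)).exists
  have := hf.val_le n (hN.trans hn2)
  rw [hf.val_eq_of_par hN hn2 (hpar n hn2)] at this
  linarith

lemma powErr_jump_le (hf : MinSeq ζ η ω f N₀) {n : ℕ} (hn : N₀ ≤ n) (i : Fin (2 + 1)) :
    |powErr ζ (multiCross ![f n, f (n + 1)]) i| ≤ 12 * (n : ℝ) ^ (1 - η) := by
  have hn1 : (1 : ℝ) ≤ n := by exact_mod_cast hf.one_le.trans hn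
  have h := abs_powErr_multiCross_le ζ (v := ![f n, f (n + 1)]) (a := fun _ => (n + 1 : ℝ))
    (θ := (n : ℝ) ^ (-η) / (n + 1)) (by positivity) (fun m i => by
      fin_cases m
      · exact (hf.height n hn i).trans (by linarith)
      · exact (hf.height (n + 1) (by omega) i).trans (by simp)) (fun m => by
      rw [mul_div_cancel₀ _ (by positivity)]
      fin_cases m
      · exact hf.val_le n hn
      · exact (hf.val_anti hn (Nat.le_succ n)).trans (hf.val_le n hn)) i
  refine h.trans ?_
  have e : ((2 + 1).factorial : ℝ) * ((∏ _m : Fin 2, ((n : ℝ) + 1)) * ((n : ℝ) ^ (-η) / (n + 1))) =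
      6 * ((n + 1) * (n : ℝ) ^ (-η)) := by
    simp [Nat.factorial]
    field_simp
  rw [e, show 1 - η = 1 + -η by ring, Real.rpow_add (by positivity), Real.rpow_one]
  have : 0 ≤ (n : ℝ) ^ (-η) := by positivity
  nlinarith

end MinSeq

namespace MinSeq

variable {ζ η ω : ℝ} {f : ℕ → Fin (2 + 1) → ℤ} {N₀ : ℕ}

lemma one_le_of_orthogonal (hf : MinSeq ζ η ω f N₀) {y : Fin (2 + 1) → ℤ} (hy0 : y ≠ 0) {M L : ℕ}
    (hM : N₀ ≤ M) (hML : ¬ Par (f M) (f L)) (h1 : ∑ i, f M i * y i = 0) (h2 : ∑ i, f L i * y i = 0)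
    {Z E : ℝ} (hZ : |((multiCross ![f M, f L] 0 : ℤ) : ℝ)| ≤ Z) (hE : ∀ i, |powErr ζ y i| ≤ E) :
    1 ≤ Z * (1 + 2 * |ζ|) * E + E ^ 2 := by
  have hx : multiCross ![f M, f L] ≠ 0 := fun h => hML (par_of_multiCross_eq_zero h)
  obtain ⟨k, l, hk, hl, hkl⟩ := multiCross_parallel hx (y := y) (fun m => by
    fin_cases m
    exacts [h1, h2]) hy0
  exact one_le_of_parallel ζ hk hl hkl
    ((hf.aniso M hM).disc_ne_zero hx (sum_mul_multiCross_self ![f M, f L] 0)) hZ hE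

lemma exists_prev_aux (hf : MinSeq ζ η ω f N₀) (hη : 2 < η) (N : ℕ) (hN : N₀ ≤ N) :
    ∃ n₁, ∀ n, n₁ ≤ n → ¬ Par (f n) (f (n + 1)) → ∃ M K, N ≤ M ∧ M + 1 ≤ K ∧ K ≤ n ∧
      ∑ i, f M i * multiCross ![f (M + 1), f (K + 1)] i ≠ 0 ∧ Par (f (M + 1)) (f K) ∧
      1 ≤ 2 * ((M + 1) * (K + 1)) * (1 + 2 * |ζ|) * (12 * (n : ℝ) ^ (1 - η)) +
        (12 * (n : ℝ) ^ (1 - η)) ^ 2 ∧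
      |linVal ζ (f (n + 1))| < |linVal ζ (f (M + 1))| := by
  classical
  obtain ⟨N', hNN', hjump⟩ := hf.exists_jump (by linarith) N hN
  set Z : ℝ := |((multiCross ![f N', f (N' + 1)] 0 : ℤ) : ℝ)| with hZ
  have hlim : Filter.Tendsto (fun n : ℕ => (n : ℝ) ^ (1 - η)) Filter.atTop (nhds 0) := by
    have := (tendsto_rpow_neg_atTop (y := η - 1) (by linarith)).comp tendsto_natCast_atTop_atTop
    simpa [Function.comp_def] using this
  have hlim2 : Filter.Tendsto (fun n : ℕ => Z * (1 + 2 * |ζ|) * (12 * (n : ℝ) ^ (1 - η)) +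
      (12 * (n : ℝ) ^ (1 - η)) ^ 2) Filter.atTop (nhds 0) := by
    have h12 := hlim.const_mul 12
    have := (h12.const_mul (Z * (1 + 2 * |ζ|))).add (h12.pow 2)
    simpa using this
  obtain ⟨n₁, hn₁⟩ := Filter.eventually_atTop.1
    ((hlim2.eventually_lt_const one_pos).and (Filter.eventually_ge_atTop (N' + 1)))
  refine ⟨n₁, fun n hn hj => ?_⟩
  obtain ⟨hsmall, hnN⟩ := hn₁ n hn
  have hn0 : N₀ ≤ n := by omega
  set y := multiCross ![f n, f (n + 1)] with hy
  have hy0 : y ≠ 0 := fun h => hj (par_of_multiCross_eq_zero h)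
  have hyE := hf.powErr_jump_le hn0
  rw [← hy] at hyE
  have hyn : ∑ i, f n i * y i = 0 := sum_mul_multiCross_self ![f n, f (n + 1)] 0
  have hyn1 : ∑ i, f (n + 1) i * y i = 0 := sum_mul_multiCross_self ![f n, f (n + 1)] 1
  have hex : ∃ M, N' ≤ M ∧ M ≤ n ∧ ∑ i, f M i * y i ≠ 0 := by
    by_contra! h
    have := hf.one_le_of_orthogonal hy0 (hN.trans hNN') hjump (h N' le_rfl (by omega))
      (h (N' + 1) (by omega) hnN) hZ.symm.le hyE
    linarith
  obtain ⟨M', hM'1, hM'2, hM'3⟩ := hex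
  set P : ℕ → Prop := fun M => ∑ i, f M i * y i ≠ 0 with hP
  set M := Nat.findGreatest P n with hM
  have hPM : P M := Nat.findGreatest_spec hM'2 hM'3
  have hM'M : M' ≤ M := Nat.le_findGreatest hM'2 hM'3
  have hMn : M < n := lt_of_le_of_ne (Nat.findGreatest_le n) fun h => by
    rw [h] at hPM
    exact hPM hyn
  have hafter : ∀ L, M < L → L ≤ n + 1 → ∑ i, f L i * y i = 0 := fun L hL1 hL2 => by
    rcases Nat.lt_or_ge n L with h | h
    · rw [show L = n + 1 by omega]
      exact hyn1
    · by_contra hne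
      exact Nat.findGreatest_is_greatest hL1 h hne
  have hM0 : N₀ ≤ M + 1 := by omega
  have hexL : ∃ L, M + 1 ≤ L ∧ ¬ Par (f (M + 1)) (f L) := by
    by_contra! h
    exact hj ((h n (by omega)).symm.trans (h (n + 1) (by omega)) (hf.ne_zero _ hM0))
  set L := Nat.find hexL with hL
  obtain ⟨hL1, hL2⟩ := Nat.find_spec hexL
  rw [← hL] at hL1 hL2
  have hLmin : ∀ K, M + 1 ≤ K → K < L → Par (f (M + 1)) (f K) := fun K h1 h2 => by
    by_contra h
    exact Nat.find_min hexL h2 ⟨h1, h⟩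
  have hLn : L ≤ n + 1 := by
    by_contra! h
    exact hj ((hLmin n (by omega) (by omega)).symm.trans (hLmin (n + 1) (by omega) h)
      (hf.ne_zero _ hM0))
  have hLM : L ≠ M + 1 := fun h => by
    rw [h] at hL2
    exact hL2 (Par.refl _)
  obtain ⟨K, hK⟩ : ∃ K, L = K + 1 := ⟨L - 1, by omega⟩
  rw [hK] at hL2
  have hx : multiCross ![f (M + 1), f (K + 1)] ≠ 0 := fun h => hL2 (par_of_multiCross_eq_zero h)
  refine ⟨M, K, by omega, by omega, by omega, fun hdet => ?_, hLmin K (by omega) (by omega), ?_, ?_⟩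
  · obtain ⟨k, l, hk, hl, hkl⟩ := multiCross_parallel hx (y := y) (fun m => by
      fin_cases m
      exacts [hafter _ (by omega) (by omega), hafter _ (by omega) (by omega)]) hy0
    apply hPM
    refine (mul_eq_zero.1 ?_).resolve_left hk
    calc k * ∑ i, f M i * y i = ∑ i, f M i * (k * y i) := by
          rw [Finset.mul_sum]
          exact Finset.sum_congr rfl fun i _ => by ring
      _ = l * ∑ i, f M i * multiCross ![f (M + 1), f (K + 1)] i := by
          rw [Finset.mul_sum]
          exact Finset.sum_congr rfl fun i _ => by rw [hkl i]; ring
      _ = 0 := by rw [hdet, mul_zero]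
  · refine hf.one_le_of_orthogonal hy0 hM0 hL2 (hafter _ (by omega) (by omega))
      (hafter _ (by omega) (by omega)) ?_ hyE
    have := abs_multiCross_zero_le (v := ![f (M + 1), f (K + 1)])
      (a := ![(M : ℝ) + 1, (K : ℝ) + 1]) (fun m i => by
        fin_cases m
        · simpa using hf.height (M + 1) hM0 i
        · simpa using hf.height (K + 1) (by omega) i)
    simpa [Fin.prod_univ_two] using this
  · refine lt_of_le_of_ne (hf.val_anti hM0 (by omega)) fun h => hL2 ?_
    refine par_of_abs_linVal_eq hf.transcendental (le_antisymm ?_ (hf.val_anti hM0 (by omega)))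
    rw [← h]
    exact hf.val_anti (by omega) (by omega)

end MinSeq

namespace MinSeq

variable {ζ η ω : ℝ} {f : ℕ → Fin (2 + 1) → ℤ} {N₀ : ℕ}

lemma exists_prev (hf : MinSeq ζ η ω f N₀) (hη : 2 < η) (hω : 0 < ω) :
    ∃ c : ℝ, ∀ N : ℕ, N₀ ≤ N → ∃ n₁, ∀ n, n₁ ≤ n → ¬ Par (f n) (f (n + 1)) → ∃ M, N ≤ M ∧
      ¬ Par (f M) (f (M + 1)) ∧
      (η - 1) * Real.log M ≤ c + Real.log n ∧
      (η - 1) * Real.log n ≤ c + (1 + ω / η) * Real.log M ∧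
      Real.log |linVal ζ (f (M + 1))| ≤ c - η * (η - 1) * Real.log M ∧
      |linVal ζ (f (n + 1))| < |linVal ζ (f (M + 1))| := by
  have hη0 : 0 < η := by linarith
  set A : ℝ := 12 * (9 + 16 * |ζ|) with hA
  have hA1 : 1 ≤ A := by linarith [abs_nonneg ζ]
  have hlA : 0 ≤ Real.log A := Real.log_nonneg hA1
  have hl2 : 0 ≤ Real.log 2 := Real.log_nonneg (by norm_num)
  have hl80 : 0 ≤ Real.log 80 := Real.log_nonneg (by norm_num)
  have hωη : 0 < ω / η := by positivity
  refine ⟨η * Real.log 80 + Real.log A + ω / η * Real.log 2, fun N hN => ?_⟩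
  obtain ⟨n₁, hn₁⟩ := hf.exists_prev_aux hη N hN
  obtain ⟨X, hX, hsmall⟩ := exists_forall_mul_rpow_le_one 12 (a := 1 - η) (by linarith)
  refine ⟨max n₁ ⌈X⌉₊, fun n hn hj => ?_⟩
  obtain ⟨M, K, hNM, hMK, hKn, hdet, hpar, hE, hlt⟩ := hn₁ n ((le_max_left _ _).trans hn) hj
  have hXn : X ≤ n := (Nat.le_ceil _).trans (by exact_mod_cast (le_max_right _ _).trans hn)
  have hE1 := hsmall n hXn
  have hM0 : N₀ ≤ M := hN.trans hNM
  have hm1 : (1 : ℝ) ≤ M := by exact_mod_cast hf.one_le.trans hM0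
  have hmk : (M : ℝ) + 1 ≤ K := by exact_mod_cast hMK
  have hkn : (K : ℝ) ≤ n := by exact_mod_cast hKn
  have hm : (0 : ℝ) < M := by linarith
  have hk : (0 : ℝ) < K := by linarith
  have hn' : (0 : ℝ) < n := by linarith
  have hlkn : Real.log K ≤ Real.log n := Real.log_le_log hk hkn
  have hlm : 0 ≤ Real.log M := Real.log_nonneg hm1
  have hv1 := hf.val_anti hM0 (Nat.le_succ M)
  have hvK : |linVal ζ (f (M + 1))| ≤ (K : ℝ) ^ (-η) := by
    rw [← hf.val_eq_of_par (by omega) hMK hpar]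
    exact hf.val_le K (by omega)
  have hvpos := hf.val_pos (N := M + 1) (by omega)
  have hlv : Real.log |linVal ζ (f (M + 1))| ≤ -η * Real.log K := by
    rw [← Real.log_rpow hk]
    exact Real.log_le_log hvpos hvK
  have h1 : (η - 1) * Real.log M ≤ Real.log 80 + Real.log K := by
    have hd : (1 : ℝ) ≤ |((∑ i, f M i * multiCross ![f (M + 1), f (K + 1)] i : ℤ) : ℝ)| := by
      rw [← Int.cast_abs]
      exact_mod_cast Int.one_le_abs hdet
    have hd2 := abs_det_three_le ζ (P := M) (Q := M + 1) (R := K + 1) (by linarith) (by linarith)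
      (by linarith) (hf.height M hM0) (fun i => by simpa using hf.height (M + 1) (by omega) i)
      (fun i => by simpa using hf.height (K + 1) (by omega) i) (hf.val_le M hM0)
      (hv1.trans (hf.val_le M hM0)) ((hf.val_anti hM0 (by omega)).trans (hf.val_le M hM0))
    have hd3 : 20 * (((M : ℝ) + 1) * (K + 1) * (M : ℝ) ^ (-η)) ≤
        20 * ((2 * M) * (2 * K) * (M : ℝ) ^ (-η)) := by
      gcongr <;> linarith
    have hd4 : 20 * ((2 * (M : ℝ)) * (2 * K) * (M : ℝ) ^ (-η)) = 80 * K * (M : ℝ) ^ (1 - η) := by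
      rw [show 1 - η = 1 + -η by ring, Real.rpow_add hm, Real.rpow_one]
      ring
    have hd5 := Real.log_le_log one_pos ((hd.trans hd2).trans (hd3.trans hd4.le))
    rw [Real.log_one, Real.log_mul (by positivity) (by positivity),
      Real.log_mul (by norm_num) hk.ne', Real.log_rpow hm] at hd5
    linarith
  have h2 : η * Real.log K ≤ ω * (Real.log 2 + Real.log M) := by
    have := (hf.lt_val (M + 1) (by omega) _ (hf.ne_zero _ (by omega))
      (hf.height (M + 1) (by omega))).le
    have h3 := (Real.log_le_log (by positivity) this).trans hlv
    have hM1 : (0 : ℝ) < ((M + 1 : ℕ) : ℝ) := by positivity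
    rw [Real.log_rpow hM1] at h3
    have h4 : Real.log ((M + 1 : ℕ) : ℝ) ≤ Real.log 2 + Real.log M := by
      rw [← Real.log_mul (by norm_num) hm.ne']
      refine Real.log_le_log hM1 ?_
      push_cast
      linarith
    nlinarith
  have h2' : Real.log K ≤ ω / η * (Real.log 2 + Real.log M) := by
    rw [div_mul_eq_mul_div, le_div_iff₀ hη0]
    linarith
  have h3 : (η - 1) * Real.log n ≤ Real.log A + Real.log M + Real.log K := by
    have hB : 1 ≤ A * M * K * (n : ℝ) ^ (1 - η) := by
      set t : ℝ := 12 * (n : ℝ) ^ (1 - η) with ht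
      have ht0 : 0 ≤ t := by positivity
      have e1 : ((M : ℝ) + 1) * (K + 1) ≤ 4 * (M * K) := by nlinarith
      have e2 : 1 ≤ (M : ℝ) * K := by nlinarith
      have e3 : 2 * (((M : ℝ) + 1) * (K + 1)) * (1 + 2 * |ζ|) * t ≤
          2 * (4 * (M * K)) * (1 + 2 * |ζ|) * t := by gcongr
      have e4 : t ^ 2 ≤ (M * K) * t := by
        rw [sq]
        exact mul_le_mul_of_nonneg_right (hE1.trans e2) ht0
      have e5 : A * M * K * (n : ℝ) ^ (1 - η) = 2 * (4 * (M * K)) * (1 + 2 * |ζ|) * t + (M * K) * t := by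
        rw [hA, ht]
        ring
      rw [e5]
      linarith
    have := Real.log_le_log one_pos hB
    rw [Real.log_one, Real.log_mul (by positivity) (by positivity),
      Real.log_mul (by positivity) hk.ne', Real.log_mul (by positivity) hm.ne',
      Real.log_rpow hn'] at this
    linarith
  have hω2 : 0 ≤ ω / η * Real.log 2 := by positivity
  have hη80 : Real.log 80 ≤ η * Real.log 80 := by nlinarith
  refine ⟨M, hNM, fun hp => hdet ?_, by linarith, by linarith, ?_, hlt⟩
  · obtain ⟨k, l, -, hl, hkl⟩ := hp.exists_mul_eq (hf.ne_zero _ hM0) (hf.ne_zero _ (by omega))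
    have h0 : ∑ i, f (M + 1) i * multiCross ![f (M + 1), f (K + 1)] i = 0 :=
      sum_mul_multiCross_self ![f (M + 1), f (K + 1)] 0
    refine (mul_eq_zero.1 ?_).resolve_left hl
    calc l * ∑ i, f M i * multiCross ![f (M + 1), f (K + 1)] i
        = k * ∑ i, f (M + 1) i * multiCross ![f (M + 1), f (K + 1)] i := by
          rw [Finset.mul_sum, Finset.mul_sum]
          exact Finset.sum_congr rfl fun i _ => by rw [← mul_assoc, ← hkl i, mul_assoc]
      _ = 0 := by rw [h0, mul_zero]
  · have : η * ((η - 1) * Real.log M) ≤ η * (Real.log 80 + Real.log K) := by gcongr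
    linarith

lemma exists_three (hf : MinSeq ζ η ω f N₀) (hη : 2 < η) (hω : 0 < ω) :
    ∃ c : ℝ, ∀ N : ℕ, N₀ ≤ N → ∃ M₁ M₂ M₃, N ≤ M₁ ∧ N ≤ M₂ ∧ N ≤ M₃ ∧
      (η - 1) * Real.log M₂ ≤ c + Real.log M₁ ∧
      (η - 1) * Real.log M₁ ≤ c + (1 + ω / η) * Real.log M₂ ∧
      (η - 1) * Real.log M₃ ≤ c + Real.log M₂ ∧
      (η - 1) * Real.log M₂ ≤ c + (1 + ω / η) * Real.log M₃ ∧
      Real.log |linVal ζ (f (M₁ + 1))| ≤ c - η * (η - 1) * Real.log M₁ ∧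
      Real.log |linVal ζ (f (M₂ + 1))| ≤ c - η * (η - 1) * Real.log M₂ ∧
      Real.log |linVal ζ (f (M₃ + 1))| ≤ c - η * (η - 1) * Real.log M₃ ∧
      ¬ Par (f (M₁ + 1)) (f (M₂ + 1)) ∧ ¬ Par (f (M₁ + 1)) (f (M₃ + 1)) := by
  obtain ⟨c, hc⟩ := hf.exists_prev hη hω
  refine ⟨c, fun N hN => ?_⟩
  obtain ⟨n₃, h₃⟩ := hc N hN
  obtain ⟨n₂, h₂⟩ := hc (max N n₃) (hN.trans (le_max_left _ _))
  obtain ⟨n₁, h₁⟩ := hc (max N n₂) (hN.trans (le_max_left _ _))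
  obtain ⟨n, hn, hj⟩ := hf.exists_jump (by linarith) (max N n₁) (hN.trans (le_max_left _ _))
  obtain ⟨M₁, hM₁, hj₁, -, -, hv₁, -⟩ := h₁ n ((le_max_right _ _).trans hn) hj
  obtain ⟨M₂, hM₂, hj₂, ha₂, hb₂, hv₂, hl₂⟩ := h₂ M₁ ((le_max_right _ _).trans hM₁) hj₁
  obtain ⟨M₃, hM₃, hj₃, ha₃, hb₃, hv₃, hl₃⟩ := h₃ M₂ ((le_max_right _ _).trans hM₂) hj₂
  have hN₁ := (le_max_left _ _).trans hM₁
  have hN₂ := (le_max_left _ _).trans hM₂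
  have key : ∀ M M', N ≤ M → N ≤ M' → |linVal ζ (f (M + 1))| < |linVal ζ (f (M' + 1))| →
      ¬ Par (f (M + 1)) (f (M' + 1)) := fun M M' hM hM' hlt hp => by
    rcases le_total M M' with h | h
    · exact absurd (hf.val_eq_of_par (by omega) (by omega) hp) hlt.ne'
    · exact absurd (hf.val_eq_of_par (by omega) (by omega) hp.symm) hlt.ne
  exact ⟨M₁, M₂, M₃, hN₁, hN₂, hM₃, ha₂, hb₂, ha₃, hb₃, hv₁, hv₂, hv₃, key _ _ hN₁ hN₂ hl₂,
    key _ _ hN₁ hM₃ (hl₂.trans hl₃)⟩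

end MinSeq

lemma multiCross_ne_zero_of_linearIndependent {n : ℕ} {v : Fin n → Fin (n + 1) → ℤ}
    (h : LinearIndependent ℚ fun m j => (v m j : ℚ)) : multiCross v ≠ 0 := by
  intro h0
  obtain ⟨u, hu⟩ := exists_linearIndependent_cons_of_lt_finrank h (by simp)
  have hdet := (Matrix.linearIndependent_rows_iff_isUnit
    (A := Matrix.of (Fin.cons u fun m j => (v m j : ℚ) : Fin (n + 1) → Fin (n + 1) → ℚ))).1 hu
  rw [Matrix.isUnit_iff_isUnit_det, isUnit_iff_ne_zero, ← sum_mul_multiCross] at hdet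
  refine hdet (Finset.sum_eq_zero fun i _ => ?_)
  have : ((multiCross v i : ℤ) : ℚ) = multiCross (fun m j => (v m j : ℚ)) i := by
    rw [multiCross, multiCross]
    push_cast
    congr 1
  rw [← this, h0]
  simp

/-- The rational polynomial of degree at most two with the given coefficients. -/
noncomputable def quadPoly (p : Fin (2 + 1) → ℤ) : ℚ[X] :=
  C (p 2 : ℚ) * X ^ 2 + C (p 1 : ℚ) * X + C (p 0 : ℚ)

lemma natDegree_quadPoly_le (p : Fin (2 + 1) → ℤ) : (quadPoly p).natDegree ≤ 2 :=
  natDegree_quadratic_le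

lemma quadPoly_coeff (p : Fin (2 + 1) → ℤ) (i : Fin (2 + 1)) :
    (quadPoly p).coeff i = p i := by
  fin_cases i <;> simp [quadPoly, coeff_X, coeff_C, -eq_intCast, -map_intCast]

lemma Aniso.two_ne_zero {p : Fin (2 + 1) → ℤ} (h : Aniso p) : p 2 ≠ 0 := fun h2 => by
  simpa using (h 1 0 (by simp [h2])).1

lemma Aniso.natDegree_quadPoly {p : Fin (2 + 1) → ℤ} (h : Aniso p) :
    (quadPoly p).natDegree = 2 :=
  natDegree_quadratic (by exact_mod_cast h.two_ne_zero)

lemma Aniso.irreducible {p : Fin (2 + 1) → ℤ} (h : Aniso p) : Irreducible (quadPoly p) := by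
  rw [irreducible_iff_roots_eq_zero_of_degree_le_three (by rw [h.natDegree_quadPoly])
    (by rw [h.natDegree_quadPoly]; norm_num), Multiset.eq_zero_iff_forall_notMem]
  intro r hr
  have hr := isRoot_of_mem_roots hr
  simp only [quadPoly, IsRoot.def, eval_add, eval_mul, eval_C, eval_pow, eval_X] at hr
  have hd : (r.den : ℚ) ≠ 0 := by exact_mod_cast r.den_ne_zero
  have hn : r * r.den = r.num := Rat.mul_den_eq_num r
  have h0 : (p 0 : ℚ) * (r.den : ℚ) ^ 2 + p 1 * r.num * r.den + p 2 * (r.num : ℚ) ^ 2 = 0 := by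
    rw [← hn]
    linear_combination (r.den : ℚ) ^ 2 * hr
  have := (h r.num r.den (by exact_mod_cast h0)).2
  exact r.den_ne_zero (by exact_mod_cast this)

lemma Aniso.par_of_dvd {p q : Fin (2 + 1) → ℤ} (h : Aniso p) (hpq : quadPoly p ∣ quadPoly q) :
    Par p q := by
  obtain ⟨g, hg⟩ := hpq
  have hg0 : g.natDegree = 0 := by
    rcases eq_or_ne g 0 with rfl | hne
    · simp
    have h1 := natDegree_mul h.irreducible.ne_zero hne
    rw [← hg, h.natDegree_quadPoly] at h1
    have := natDegree_quadPoly_le q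
    omega
  rw [eq_C_of_natDegree_eq_zero hg0] at hg
  have key : ∀ i : Fin (2 + 1), (q i : ℚ) = p i * g.coeff 0 := fun i => by
    rw [← quadPoly_coeff, hg, coeff_mul_C, quadPoly_coeff]
  intro i j
  have : (p i : ℚ) * q j = p j * q i := by
    rw [key i, key j]
    ring
  exact_mod_cast this

/-- The coefficients of the product of two polynomials of degree at most two. -/
def quadMul (p q : Fin (2 + 1) → ℤ) : Fin (4 + 1) → ℤ :=
  ![p 0 * q 0, p 0 * q 1 + p 1 * q 0, p 0 * q 2 + p 1 * q 1 + p 2 * q 0, p 1 * q 2 + p 2 * q 1,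
    p 2 * q 2]

/-- The multiples of `p` by `1`, `X`, `X ^ 2`, and the product of `q` and `r`. -/
def quadRows (p q r : Fin (2 + 1) → ℤ) : Fin 4 → Fin (4 + 1) → ℤ :=
  ![![p 0, p 1, p 2, 0, 0], ![0, p 0, p 1, p 2, 0], ![0, 0, p 0, p 1, p 2], quadMul q r]

lemma multiCross_quadRows_ne_zero {p q r : Fin (2 + 1) → ℤ} (hp : Aniso p) (hq : ¬ Par p q)
    (hr : ¬ Par p r) : multiCross (quadRows p q r) ≠ 0 := by
  refine multiCross_ne_zero_of_linearIndependent (Fintype.linearIndependent_iff.2 fun g hg => ?_)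
  have e : ∀ i, _ := fun i => congrFun hg i
  have e0 := e 0
  have e1 := e 1
  have e2 := e 2
  have e3 := e 3
  have e4 := e 4
  simp [Fin.sum_univ_succ, quadRows, quadMul] at e0 e1 e2 e3 e4
  have hpoly : (C (g 0) + C (g 1) * X + C (g 2) * X ^ 2) * quadPoly p +
      C (g 3) * (quadPoly q * quadPoly r) = 0 := by
    have h0 := congrArg (C (R := ℚ)) e0
    have h1 := congrArg (C (R := ℚ)) e1
    have h2 := congrArg (C (R := ℚ)) e2
    have h3 := congrArg (C (R := ℚ)) e3
    have h4 := congrArg (C (R := ℚ)) e4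
    simp only [C_add, C_mul, C_0] at h0 h1 h2 h3 h4
    simp only [quadPoly]
    linear_combination h0 + X * h1 + X ^ 2 * h2 + X ^ 3 * h3 + X ^ 4 * h4
  have hp2 : (p 2 : ℚ) ≠ 0 := by exact_mod_cast hp.two_ne_zero
  have g3 : g 3 = 0 := by
    by_contra h3
    have hd : quadPoly p ∣ C (g 3) * (quadPoly q * quadPoly r) :=
      ⟨-(C (g 0) + C (g 1) * X + C (g 2) * X ^ 2), by linear_combination hpoly⟩
    rw [(isUnit_C.2 (isUnit_iff_ne_zero.2 h3)).dvd_mul_left] at hd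
    rcases hp.irreducible.prime.dvd_or_dvd hd with h | h
    exacts [hq (hp.par_of_dvd h), hr (hp.par_of_dvd h)]
  have g2 : g 2 = 0 := by simpa [g3, hp2] using e4
  have g1 : g 1 = 0 := by simpa [g3, g2, hp2] using e3
  have g0 : g 0 = 0 := by simpa [g3, g2, g1, hp2] using e2
  intro i
  fin_cases i
  exacts [g0, g1, g2, g3]

lemma linVal_quadMul (ζ : ℝ) (p q : Fin (2 + 1) → ℤ) :
    linVal ζ (quadMul p q) = linVal ζ p * linVal ζ q := by
  rw [linVal_three, linVal_three, linVal]
  simp [Fin.sum_univ_succ, quadMul]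
  ring

lemma abs_quadMul_le {p q : Fin (2 + 1) → ℤ} {Y Z : ℝ} (hp : ∀ i, |(p i : ℝ)| ≤ Y)
    (hq : ∀ i, |(q i : ℝ)| ≤ Z) (i : Fin (4 + 1)) : |(quadMul p q i : ℝ)| ≤ 3 * (Y * Z) := by
  have hY : 0 ≤ Y := (abs_nonneg _).trans (hp 0)
  have hZ : 0 ≤ Z := (abs_nonneg _).trans (hq 0)
  have h : ∀ i j, |(p i : ℝ) * q j| ≤ Y * Z := fun i j => by
    rw [abs_mul]
    gcongr
    exacts [hp i, hq j]
  have hYZ : 0 ≤ Y * Z := mul_nonneg hY hZ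
  have hs : ∀ i j k l : Fin (2 + 1), |(p i : ℝ) * q j + p k * q l| ≤ 2 * (Y * Z) :=
    fun i j k l => (abs_add_le _ _).trans (by linarith [h i j, h k l])
  fin_cases i
  · simpa [quadMul] using (h 0 0).trans (by linarith)
  · simpa [quadMul] using (hs 0 1 1 0).trans (by linarith)
  · simpa [quadMul] using (abs_add_le _ ((p 2 : ℝ) * q 0)).trans
      (by linarith [hs 0 2 1 1, h 2 0] : |(p 0 : ℝ) * q 2 + p 1 * q 1| + |(p 2 : ℝ) * q 0| ≤ _)
  · simpa [quadMul] using (hs 1 2 2 1).trans (by linarith)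
  · simpa [quadMul] using (h 2 2).trans (by linarith)

lemma abs_quadRows_le {p q r : Fin (2 + 1) → ℤ} {X Y Z : ℝ} (hp : ∀ i, |(p i : ℝ)| ≤ X)
    (hq : ∀ i, |(q i : ℝ)| ≤ Y) (hr : ∀ i, |(r i : ℝ)| ≤ Z) (h : 3 * (Y * Z) ≤ X)
    (m : Fin 4) (i : Fin (4 + 1)) : |(quadRows p q r m i : ℝ)| ≤ X := by
  have h0 : 0 ≤ X := (abs_nonneg _).trans (hp 0)
  have h3 : |(quadRows p q r 3 i : ℝ)| ≤ X := (abs_quadMul_le hq hr i).trans h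
  fin_cases m
  · fin_cases i <;> simp [quadRows, h0, hp]
  · fin_cases i <;> simp [quadRows, h0, hp]
  · fin_cases i <;> simp [quadRows, h0, hp]
  · exact h3

lemma abs_linVal_quadRows_le {ζ : ℝ} {p q r : Fin (2 + 1) → ℤ} {E : ℝ}
    (hp : max 1 |ζ| ^ 2 * |linVal ζ p| ≤ E) (hqr : |linVal ζ q| * |linVal ζ r| ≤ E) (m : Fin 4) :
    |linVal ζ (quadRows p q r m)| ≤ E := by
  have hpow : ∀ k ≤ 2, |ζ ^ k * linVal ζ p| ≤ E := fun k hk => by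
    rw [abs_mul]
    exact le_trans (by gcongr; exact abs_pow_le_max_one_pow ζ hk) hp
  have hlin := linVal_three ζ p
  have h3 : |linVal ζ (quadRows p q r 3)| ≤ E := by
    change |linVal ζ (quadMul q r)| ≤ E
    rwa [linVal_quadMul, abs_mul]
  fin_cases m
  · convert hpow 0 (by norm_num) using 2
    rw [hlin, linVal]
    simp [Fin.sum_univ_succ, quadRows]
    ring
  · convert hpow 1 (by norm_num) using 2
    rw [hlin, linVal]
    simp [Fin.sum_univ_succ, quadRows]
    ring
  · convert hpow 2 (by norm_num) using 2
    rw [hlin, linVal]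
    simp [Fin.sum_univ_succ, quadRows]
    ring
  · exact h3

lemma eventually_le_mul_log (C : ℝ) {k : ℝ} (hk : 0 < k) :
    ∀ᶠ N : ℕ in Filter.atTop, ∀ M : ℕ, N ≤ M → C ≤ k * Real.log M := by
  have h : Filter.Tendsto (fun M : ℕ => k * Real.log M) Filter.atTop Filter.atTop :=
    (Real.tendsto_log_atTop.comp tendsto_natCast_atTop_atTop).const_mul_atTop hk
  exact Filter.eventually_forall_ge_atTop.2 (h.eventually (Filter.eventually_ge_atTop C))

/-- Four independent small quartic forms built from three quadratic ones. -/
lemma MinSeq.exists_four {ζ η ω : ℝ} {f : ℕ → Fin (2 + 1) → ℤ} {N₀ : ℕ}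
    (hf : MinSeq ζ η ω f N₀) (hη : 2 < η) (hω : 0 < ω) {s θ : ℝ} (hs : 1 < s)
    (hsa : 1 / (η - 1) + 1 / (η - 1) ^ 2 < s) (hθ : s * θ < η * (η - 1))
    (hθB : s * θ < η * (η - 1) *
      ((η - 1) / (1 + ω / η) + ((η - 1) / (1 + ω / η)) ^ 2)) (X₀ : ℝ) :
    ∃ X, X₀ ≤ X ∧ ∃ v : Fin 4 → Fin (4 + 1) → ℤ,
      multiCross v ≠ 0 ∧ (∀ m i, |(v m i : ℝ)| ≤ X) ∧ ∀ m, |linVal ζ (v m)| ≤ X ^ (-θ) := by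
  obtain ⟨c, hc⟩ := hf.exists_three hη hω
  set a : ℝ := η - 1 with ha
  set B : ℝ := 1 + ω / η with hB
  set W : ℝ := max 1 |ζ| ^ 2 with hW
  have hW1 : 1 ≤ W := one_le_pow₀ (le_max_left _ _)
  have ha0 : 0 < a := by linarith
  have hB0 : 0 < B := by positivity
  obtain ⟨N, ⟨⟨⟨⟨⟨hN, hX⟩, h2⟩, h12⟩, hQ⟩, hR⟩⟩ :=
    (((((Filter.eventually_ge_atTop N₀).and (Filter.eventually_ge_atTop ⌈X₀⌉₊)).and
    (eventually_le_mul_log (Real.log 2) (sub_pos.2 hs))).and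
    (eventually_le_mul_log (Real.log 12 + (c / a + (c / a + c / a ^ 2))) (sub_pos.2 hsa))).and
    (eventually_le_mul_log (Real.log W + c) (sub_pos.2 hθ))).and
    (eventually_le_mul_log (2 * c + η * a * (c / B + (a * c / B ^ 2 + c / B)))
      (sub_pos.2 hθB)) |>.exists
  obtain ⟨M₁, M₂, M₃, hM₁, hM₂, hM₃, hu₂, hl₂, hu₃, hl₃, hv₁, hv₂, hv₃, hp₂, hp₃⟩ := hc N hN
  have h2 := h2 M₁ hM₁
  have h12 := h12 M₁ hM₁
  have hQ := hQ M₁ hM₁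
  have hR := hR M₁ hM₁
  have hm : ∀ M, N ≤ M → (1 : ℝ) ≤ M := fun M hM => by
    exact_mod_cast hf.one_le.trans (hN.trans hM)
  have hm₁ := hm M₁ hM₁
  have hm₂ := hm M₂ hM₂
  have hm₃ := hm M₃ hM₃
  have hpos : ∀ M, N ≤ M → 0 < |linVal ζ (f (M + 1))| := fun M hM =>
    hf.val_pos (by omega)
  have hh : ∀ M, N ≤ M → ∀ i, |(f (M + 1) i : ℝ)| ≤ 2 * M := fun M hM i => by
    refine (hf.height (M + 1) (by omega) i).trans ?_
    push_cast
    linarith [hm M hM]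
  set l₁ := Real.log M₁
  set l₂ := Real.log M₂
  set l₃ := Real.log M₃
  have hu₂' : l₂ ≤ c / a + l₁ / a := by
    rw [← add_div, le_div_iff₀ ha0]
    linarith
  have hu₃' : l₃ ≤ c / a + (c / a ^ 2 + l₁ / a ^ 2) := by
    have e : c / a ^ 2 + l₁ / a ^ 2 = (c / a + l₁ / a) / a := by field_simp
    rw [e, ← add_div, le_div_iff₀ ha0]
    linarith
  have hl₂' : a / B * l₁ - c / B ≤ l₂ := by
    rw [div_mul_eq_mul_div, ← sub_div, div_le_iff₀ hB0]
    linarith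
  have hl₃' : (a / B) ^ 2 * l₁ - a * c / B ^ 2 - c / B ≤ l₃ := by
    have e : (a / B) ^ 2 * l₁ - a * c / B ^ 2 - c / B = (a * (a / B * l₁ - c / B) - c) / B := by
      field_simp
    rw [e, div_le_iff₀ hB0]
    have := mul_le_mul_of_nonneg_left hl₂' ha0.le
    linarith
  have hX0 : (0 : ℝ) < (M₁ : ℝ) ^ s := by positivity
  have hlX : Real.log ((M₁ : ℝ) ^ s) = s * l₁ := Real.log_rpow (by linarith) s
  have hlE : Real.log (((M₁ : ℝ) ^ s) ^ (-θ)) = -θ * (s * l₁) := by rw [Real.log_rpow hX0, hlX]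
  refine ⟨(M₁ : ℝ) ^ s, ?_, quadRows (f (M₁ + 1)) (f (M₂ + 1)) (f (M₃ + 1)),
    multiCross_quadRows_ne_zero (hf.aniso _ (by omega)) hp₂ hp₃,
    abs_quadRows_le (fun i => (hh M₁ hM₁ i).trans ?_) (hh M₂ hM₂) (hh M₃ hM₃) ?_,
    abs_linVal_quadRows_le ?_ ?_⟩
  · have : X₀ ≤ M₁ := (Nat.le_ceil _).trans (by exact_mod_cast hX.trans hM₁)
    exact this.trans (Real.self_le_rpow_of_one_le hm₁ hs.le)
  · rw [← Real.log_le_log_iff (by positivity) hX0, hlX, Real.log_mul (by norm_num) (by positivity)]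
    linarith
  · rw [show 3 * (2 * (M₂ : ℝ) * (2 * M₃)) = 12 * (M₂ * M₃) by ring,
      ← Real.log_le_log_iff (by positivity) hX0, hlX, Real.log_mul (by norm_num) (by positivity),
      Real.log_mul (by positivity) (by positivity)]
    have e : (s - (1 / a + 1 / a ^ 2)) * l₁ = s * l₁ - (l₁ / a + l₁ / a ^ 2) := by ring
    rw [e] at h12
    linarith
  · rw [← Real.log_le_log_iff (mul_pos (by positivity) (hpos M₁ hM₁)) (by positivity), hlE,
      Real.log_mul (by positivity) (hpos M₁ hM₁).ne']
    linarith
  · rw [← Real.log_le_log_iff (mul_pos (hpos M₂ hM₂) (hpos M₃ hM₃)) (by positivity), hlE,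
      Real.log_mul (hpos M₂ hM₂).ne' (hpos M₃ hM₃).ne']
    have := mul_le_mul_of_nonneg_left (add_le_add hl₂' hl₃') (a := η * a) (by positivity)
    linarith

/-- Exponents near the extremal ones meet the requirements of `MinSeq.exists_four`. -/
lemma exists_near_extremal {s θ : ℝ} (hs : 1 < s) (hθ : s * θ < 2 + √5) :
    ∃ δ : ℝ, 0 < δ ∧ 2 < (3 + √5) / 2 - δ ∧
      1 / ((3 + √5) / 2 - δ - 1) + 1 / ((3 + √5) / 2 - δ - 1) ^ 2 < s ∧
      s * θ < ((3 + √5) / 2 - δ) * ((3 + √5) / 2 - δ - 1) ∧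
      s * θ < ((3 + √5) / 2 - δ) * ((3 + √5) / 2 - δ - 1) *
        (((3 + √5) / 2 - δ - 1) / (1 + (2 + √5 + δ) / ((3 + √5) / 2 - δ)) +
          (((3 + √5) / 2 - δ - 1) / (1 + (2 + √5 + δ) / ((3 + √5) / 2 - δ))) ^ 2) := by
  have h5 : √5 ^ 2 = 5 := Real.sq_sqrt (by norm_num)
  have h50 : 0 ≤ √5 := Real.sqrt_nonneg 5
  have h52 : 2 < √5 := Real.lt_sqrt_of_sq_lt (by norm_num)
  have ha : (3 + √5) / 2 - 0 - 1 ≠ 0 := by linarith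
  have hη : (3 + √5) / 2 - 0 ≠ 0 := by linarith
  have hB : 1 + (2 + √5 + 0) / ((3 + √5) / 2 - 0) = (3 + √5) / 2 := by
    rw [show (2 + √5 + 0) / ((3 + √5) / 2 - 0) = (1 + √5) / 2 by
      rw [div_eq_iff hη]
      linear_combination -h5 / 4]
    ring
  have hB0 : 1 + (2 + √5 + 0) / ((3 + √5) / 2 - 0) ≠ 0 := by rw [hB]; linarith
  have hq : 1 / ((3 + √5) / 2 - 0 - 1) + 1 / ((3 + √5) / 2 - 0 - 1) ^ 2 = 1 := by
    rw [div_add_div _ _ ha (pow_ne_zero 2 ha), div_eq_one_iff_eq (by positivity)]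
    linear_combination (-(√5 + 1) / 8) * h5
  have hw : ((3 + √5) / 2 - 0) * ((3 + √5) / 2 - 0 - 1) = 2 + √5 := by
    linear_combination h5 / 4
  have hq' : ((3 + √5) / 2 - 0 - 1) / ((3 + √5) / 2) + (((3 + √5) / 2 - 0 - 1) / ((3 + √5) / 2)) ^ 2
      = 1 := by
    field_simp
    linear_combination h5
  have c1 : ContinuousAt (fun δ : ℝ => (3 + √5) / 2 - δ) 0 := by fun_prop
  have c2 : ContinuousAt (fun δ : ℝ => 1 / ((3 + √5) / 2 - δ - 1) +
      1 / ((3 + √5) / 2 - δ - 1) ^ 2) 0 := by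
    fun_prop (disch := simpa using ha)
  have c3 : ContinuousAt (fun δ : ℝ => ((3 + √5) / 2 - δ) * ((3 + √5) / 2 - δ - 1)) 0 := by
    fun_prop
  have c4 : ContinuousAt (fun δ : ℝ => ((3 + √5) / 2 - δ - 1) /
      (1 + (2 + √5 + δ) / ((3 + √5) / 2 - δ))) 0 := by
    refine ContinuousAt.div (by fun_prop) (.add (by fun_prop) (.div (by fun_prop) c1 hη)) hB0
  have e1 := c1.eventually_const_lt (show 2 < (3 + √5) / 2 - 0 by linarith)
  have e2 := c2.eventually_lt_const (hq.trans_lt hs)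
  have e3 := c3.eventually_const_lt (hθ.trans_eq hw.symm)
  have e4 := (c3.mul (c4.add (c4.pow 2))).eventually_const_lt
    (hθ.trans_eq (by
      simp only [Pi.mul_apply, Pi.add_apply, Pi.pow_apply]
      rw [hB, hq', hw, mul_one]))
  have h := (e1.and (e2.and (e3.and e4))).filter_mono (nhdsWithin_le_nhds (s := Set.Ioi (0 : ℝ)))
  obtain ⟨δ, hδ, h⟩ := (Filter.Eventually.and (self_mem_nhdsWithin (s := Set.Ioi (0 : ℝ))) h).exists
  exact ⟨δ, hδ, h⟩

theorem extremal_uniform4 (ζ : ℝ) (hζ : IsExtremal ζ)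
    (hw : wExp 4 ζ = 2 + Real.sqrt 5) :
    whExp 4 ζ = 4 ∧ lamhExp 4 ζ = 1 / 4 := by
  obtain ⟨hζ, hwh⟩ := hζ
  have h52 : 2 < √5 := Real.lt_sqrt_of_sq_lt (by norm_num)
  have hw0 : 0 < wExp 4 ζ := by rw [hw]; linarith
  have hw4 : 4 < 2 + √5 := by linarith
  have hlow : ∀ ω, 2 + √5 < ω → ∃ X₁ : ℝ, 1 ≤ X₁ ∧ ∀ Y, X₁ ≤ Y → ∀ p : Fin (4 + 1) → ℤ, p ≠ 0 →
      (∀ i, |(p i : ℝ)| ≤ Y) → Y ^ (-ω) < |linVal ζ p| := fun ω hω =>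
    lt_abs_linVal_of_notMem_wSet hζ le_rfl (notMem_wSet_of_wExp_lt hw0 (by rwa [hw]))
  have hfour : ∀ ε, 0 < ε → ∀ X₀ : ℝ, ∃ X, X₀ ≤ X ∧ ∃ v : Fin 4 → Fin (4 + 1) → ℤ,
      multiCross v ≠ 0 ∧ (∀ m i, |(v m i : ℝ)| ≤ X) ∧
      ∀ m, |linVal ζ (v m)| ≤ X ^ (-(2 + √5) + ε) := by
    intro ε hε X₀
    have hw' : 0 < 2 + √5 := by linarith
    obtain ⟨δ, hδ, hη, hsa, hθ, hθB⟩ := exists_near_extremal (s := 1 + ε / (2 + √5))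
      (θ := 2 + √5 - ε) (by linarith [div_pos hε hw']) (by
        have : (1 + ε / (2 + √5)) * (2 + √5 - ε) = 2 + √5 - ε * ε / (2 + √5) := by
          field_simp
          ring
        linarith [div_pos (mul_pos hε hε) hw'])
    obtain ⟨f, N₀, hf⟩ := exists_minSeq hζ hη
      (mem_whSet_of_lt_whExp (by rw [hwh]; linarith) (by rw [hwh]; linarith))
      (notMem_wSet_of_wExp_lt hw0 (ω := 2 + √5 + δ) (by rw [hw]; linarith))
    have := hf.exists_four hη (by linarith) (by linarith [div_pos hε hw']) hsa hθ hθB X₀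
    rwa [neg_sub, sub_eq_neg_add] at this
  exact ⟨whExp_four_eq hw4 hlow hfour hζ, lamhExp_four_eq hw4 hlow hfour⟩
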